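/- Let K ⊂ ℝ³ be a convex body and α > 0. Suppose there is a continuous system of lines 𝓛 in ℝ³ whose center is contained in the interior of K, and for every line L ∈ 𝓛 there are two planes H₁, H₂ with H₁ ∩ H₂ = L, forming an angle at least α with each other, such that bd K ∩ H₁ and bd K ∩ H₂ are ellipses. Then bd K is an ellipsoid. -/

import Mathlib

open scoped RealInnerProductSpace
open MeasureTheory

noncomputable section

/-- Euclidean 3-space. -/
abbrev E3 : Type := EuclideanSpace ℝ (Fin 3)

/-- The line through `p` with direction vector `v`. -/
def lineThrough (p v : E3) : Set E3 := {x : E3 | ∃ t : ℝ, x = p + t • v}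

/-- A line in `ℝ³`. -/
def IsLine (L : Set E3) : Prop := ∃ p v : E3, v ≠ 0 ∧ L = lineThrough p v

/-- A plane in `ℝ³` with prescribed unit normal `n`. -/
def IsPlaneWithNormal (H : Set E3) (n : E3) : Prop :=
  ‖n‖ = 1 ∧ ∃ c : ℝ, H = {x : E3 | ⟪n, x⟫ = c}

/-- A plane in `ℝ³`. -/
def IsPlane (H : Set E3) : Prop := ∃ n : E3, IsPlaneWithNormal H n

/-- The unit circle `{(cos t, sin t, 0)}` in the plane `z = 0`. -/
def unitCircle3 : Set E3 := {x : E3 | x 0 ^ 2 + x 1 ^ 2 = 1 ∧ x 2 = 0}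

/-- An ellipse in `ℝ³`: the image of the unit circle under an invertible affine map. -/
def IsEllipse (E : Set E3) : Prop := ∃ f : E3 ≃ᵃ[ℝ] E3, E = f '' unitCircle3

/-- An ellipsoid in `ℝ³`: the image of the unit sphere under an invertible affine map. -/
def IsEllipsoid (S : Set E3) : Prop := ∃ f : E3 ≃ᵃ[ℝ] E3, S = f '' Metric.sphere (0 : E3) 1

/-- A circle in `ℝ³`: the points of some plane at fixed positive distance from a
center lying in that plane. -/
def IsCircle (C : Set E3) : Prop :=
  ∃ (H : Set E3) (c : E3) (r : ℝ), IsPlane H ∧ c ∈ H ∧ 0 < r ∧ C = {x ∈ H | dist x c = r}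

/-- A sphere in `ℝ³`. -/
def IsSphere (S : Set E3) : Prop := ∃ (c : E3) (r : ℝ), 0 < r ∧ S = Metric.sphere c r

/-- A convex body: compact, convex, with nonempty interior. -/
def IsConvexBody (K : Set E3) : Prop := IsCompact K ∧ Convex ℝ K ∧ (interior K).Nonempty

/-- A line `L` is tangent to `bd K` if it meets `K` but not the interior of `K`. -/
def IsTangentLine (K L : Set E3) : Prop := (L ∩ K).Nonempty ∧ L ∩ interior K = ∅

/-- An outward function on the boundary of a convex body `K`. -/
def IsOutwardFunction (K : Set E3) (Ψ : E3 → E3) : Prop :=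
  ContinuousOn Ψ (frontier K) ∧
  ∀ p ∈ frontier K, ‖Ψ p‖ = 1 ∧
    ¬ IsTangentLine K (lineThrough p (Ψ p)) ∧
    (∀ t : ℝ, 0 < t → p + t • Ψ p ∉ K) ∧
    ∃ q ∈ frontier K, q ∉ lineThrough p (Ψ p) ∧
      (lineThrough p (Ψ p) ∩ lineThrough q (Ψ q) ∩ interior K).Nonempty

/-- `L` is a line parallel to the direction `u`. -/
def LineParallel (L : Set E3) (u : E3) : Prop := ∃ p : E3, L = lineThrough p u

/-- A system of lines: for every direction `u ∈ S²` exactly one member line parallel to `u`. -/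
def IsLineSystem (𝓛 : Set (Set E3)) : Prop :=
  (∀ L ∈ 𝓛, IsLine L) ∧ ∀ u : E3, ‖u‖ = 1 → ∃! L, L ∈ 𝓛 ∧ LineParallel L u

/-- A continuous system of lines: the map `δ` sending each direction `u ∈ S²` to the point
of `L_u` closest to the origin is continuous. -/
def IsContinuousLineSystem (𝓛 : Set (Set E3)) : Prop :=
  IsLineSystem 𝓛 ∧ ∃ δ : E3 → E3, ContinuousOn δ (Metric.sphere (0 : E3) 1) ∧
    ∀ u : E3, ‖u‖ = 1 → ∀ L ∈ 𝓛, LineParallel L u →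
      δ u ∈ L ∧ ∀ x ∈ L, ‖δ u‖ ≤ ‖x‖

/-- The center of a system of lines: points lying on at least two distinct lines. -/
def lineSystemCenter (𝓛 : Set (Set E3)) : Set E3 :=
  {x : E3 | ∃ L₁ ∈ 𝓛, ∃ L₂ ∈ 𝓛, L₁ ≠ L₂ ∧ x ∈ L₁ ∧ x ∈ L₂}

/-- A smooth convex body: each boundary point has a unique (unit outer normal of a)
support plane. -/
def IsSmoothBody (K : Set E3) : Prop :=
  ∀ p ∈ frontier K, ∃! n : E3, ‖n‖ = 1 ∧ ∀ x ∈ K, ⟪n, x⟫ ≤ ⟪n, p⟫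

/-- A strictly convex body: the boundary contains no line segment. -/
def IsStrictlyConvexBody (K : Set E3) : Prop :=
  ∀ x ∈ frontier K, ∀ y ∈ frontier K, x ≠ y → ¬ segment ℝ x y ⊆ frontier K

/-- `η` is an outer unit normal field of `K` on its boundary. -/
def IsOuterNormal (K : Set E3) (η : E3 → E3) : Prop :=
  ∀ p ∈ frontier K, ‖η p‖ = 1 ∧ ∀ x ∈ K, ⟪η p, x⟫ ≤ ⟪η p, p⟫

/-- The boundary of `K` is a `C^k` surface: locally, after a rigid motion, it is the graph
of a `C^k` function of two variables. -/
def HasContDiffBoundary (K : Set E3) (k : ℕ) : Prop :=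
  ∀ p ∈ frontier K, ∃ (e : E3 ≃ᵃⁱ[ℝ] E3) (g : ℝ × ℝ → ℝ) (U : Set E3),
    IsOpen U ∧ p ∈ U ∧ ContDiff ℝ k g ∧
    frontier K ∩ U = {x ∈ U | e x 2 = g (e x 0, e x 1)}

end

section

variable {K : Set E3}

/-- The cross product on Euclidean 3-space. -/
def cross3 (a b : E3) : E3 :=
  !₂[a 1 * b 2 - a 2 * b 1, a 2 * b 0 - a 0 * b 2, a 0 * b 1 - a 1 * b 0]

theorem inner_E3 (a b : E3) : ⟪a, b⟫ = a 0 * b 0 + a 1 * b 1 + a 2 * b 2 := by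
  simp [PiLp.inner_apply, Fin.sum_univ_three, mul_comm]

@[simp] theorem cross3_zero (a b : E3) : cross3 a b 0 = a 1 * b 2 - a 2 * b 1 := rfl
@[simp] theorem cross3_one (a b : E3) : cross3 a b 1 = a 2 * b 0 - a 0 * b 2 := rfl
@[simp] theorem cross3_two (a b : E3) : cross3 a b 2 = a 0 * b 1 - a 1 * b 0 := rfl

theorem ext_E3 {a b : E3} (h0 : a 0 = b 0) (h1 : a 1 = b 1) (h2 : a 2 = b 2) : a = b := by
  ext i; fin_cases i <;> assumption

theorem inner_left_cross3 (a b : E3) : ⟪a, cross3 a b⟫ = 0 := by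
  rw [inner_E3]; simp; ring

theorem inner_right_cross3 (a b : E3) : ⟪b, cross3 a b⟫ = 0 := by
  rw [inner_E3]; simp; ring

theorem inner_cross3_rotate (a b c : E3) : ⟪a, cross3 b c⟫ = ⟪b, cross3 c a⟫ := by
  simp only [inner_E3, cross3_zero, cross3_one, cross3_two]; ring

theorem inner_cross3_swap (a b c : E3) : ⟪a, cross3 c b⟫ = -⟪a, cross3 b c⟫ := by
  simp only [inner_E3, cross3_zero, cross3_one, cross3_two]; ring

theorem cross3_expansion (a b c x : E3) :
    ⟪a, cross3 b c⟫ • x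
      = ⟪a, x⟫ • cross3 b c + ⟪b, x⟫ • cross3 c a + ⟪c, x⟫ • cross3 a b := by
  apply ext_E3 <;>
  simp only [inner_E3, PiLp.add_apply, PiLp.smul_apply, smul_eq_mul, cross3_zero, cross3_one,
    cross3_two] <;> ring

theorem cross3_cross3 (v a b : E3) : cross3 v (cross3 a b) = ⟪v, b⟫ • a - ⟪v, a⟫ • b := by
  apply ext_E3 <;>
  simp only [inner_E3, PiLp.sub_apply, PiLp.smul_apply, smul_eq_mul, cross3_zero, cross3_one,
    cross3_two] <;> ring

theorem norm_sq_cross3 (a b : E3) :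
    ⟪cross3 a b, cross3 a b⟫ = ⟪a, a⟫ * ⟪b, b⟫ - ⟪a, b⟫ ^ 2 := by
  simp only [inner_E3, cross3_zero, cross3_one, cross3_two]; ring

/-- A vector orthogonal to two independent vectors is a multiple of their cross product. -/
theorem exists_eq_smul_cross3 {a b u : E3} (h : cross3 a b ≠ 0) (ha : ⟪a, u⟫ = 0)
    (hb : ⟪b, u⟫ = 0) : ∃ k : ℝ, u = k • cross3 a b := by
  have hc : ⟪cross3 a b, cross3 a b⟫ ≠ 0 := by simpa using h
  have key := cross3_expansion (cross3 a b) a b u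
  rw [ha, hb] at key
  refine ⟨⟪cross3 a b, cross3 a b⟫⁻¹ * ⟪cross3 a b, u⟫, ?_⟩
  rw [mul_smul, eq_inv_smul_iff₀ hc, key]
  simp

/-- Two planes through the origin share a nonzero vector. -/
theorem exists_ne_zero_inner_eq_zero (a b : E3) :
    ∃ u : E3, u ≠ 0 ∧ ⟪a, u⟫ = 0 ∧ ⟪b, u⟫ = 0 := by
  obtain ⟨u, hu, hne⟩ := (Submodule.ne_bot_iff _).mp
    (LinearMap.ker_ne_bot_of_finrank_lt (f := (innerₗ E3 a).prod (innerₗ E3 b)) (by simp))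
  have hu' : (⟪a, u⟫, ⟪b, u⟫) = ((0, 0) : ℝ × ℝ) := hu
  rw [Prod.mk_inj] at hu'
  exact ⟨u, hne, hu'.1, hu'.2⟩

/-- Real-valued quadratic functions on Euclidean 3-space. -/
def IsQuad (q : E3 → ℝ) : Prop :=
  ∃ (M : E3 →ₗ[ℝ] E3 →ₗ[ℝ] ℝ) (l : E3 →ₗ[ℝ] ℝ) (c : ℝ), ∀ x, q x = M x x + l x + c

namespace IsQuad

theorem add {p q : E3 → ℝ} (hp : IsQuad p) (hq : IsQuad q) : IsQuad fun x => p x + q x := by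
  obtain ⟨M, l, c, h⟩ := hp
  obtain ⟨M', l', c', h'⟩ := hq
  exact ⟨M + M', l + l', c + c', fun x => by simp [h, h']; ring⟩

theorem const_mul {q : E3 → ℝ} (hq : IsQuad q) (k : ℝ) : IsQuad fun x => k * q x := by
  obtain ⟨M, l, c, h⟩ := hq
  exact ⟨k • M, k • l, k * c, fun x => by simp [h]; ring⟩

theorem sub {p q : E3 → ℝ} (hp : IsQuad p) (hq : IsQuad q) : IsQuad fun x => p x - q x := by
  simpa [sub_eq_add_neg] using hp.add (hq.const_mul (-1))

theorem const (c : ℝ) : IsQuad fun _ => c := ⟨0, 0, c, fun x => by simp⟩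

theorem comp_affine {q : E3 → ℝ} (hq : IsQuad q) (f : E3 →ᵃ[ℝ] E3) : IsQuad fun x => q (f x) := by
  obtain ⟨M, l, c, h⟩ := hq
  refine ⟨M.compl₁₂ f.linear f.linear, M (f 0) ∘ₗ f.linear + M.flip (f 0) ∘ₗ f.linear
    + l ∘ₗ f.linear, q (f 0), fun x => ?_⟩
  have : f x = f.linear x + f 0 := congrFun f.decomp x
  beta_reduce
  rw [this]
  simp [h]; ring

theorem mul_affine (n m : E3) (c d : ℝ) : IsQuad fun x => (⟪n, x⟫ - c) * (⟪m, x⟫ - d) := by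
  refine ⟨(innerₗ E3 n).smulRight (innerₗ E3 m), -d • innerₗ E3 n - c • innerₗ E3 m, c * d,
    fun x => by simp; ring⟩

/-- A quadratic function in affine coordinates. -/
theorem expand {q : E3 → ℝ} (hq : IsQuad q) (o a b c : E3) :
    ∃ A B C D E F G H I : ℝ, ∀ s t r : ℝ, q (o + s • a + t • b + r • c)
      = A * s ^ 2 + B * t ^ 2 + C * r ^ 2 + D * (s * t) + E * (t * r) + F * (s * r)
        + G * s + H * t + I * r + q o := by
  obtain ⟨M, l, k, h⟩ := hq
  refine ⟨M a a, M b b, M c c, M a b + M b a, M b c + M c b, M a c + M c a,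
    M o a + M a o + l a, M o b + M b o + l b, M o c + M c o + l c, fun s t r => ?_⟩
  simp [h]; ring

theorem expand₂ {q : E3 → ℝ} (hq : IsQuad q) (o a b : E3) :
    ∃ A B C D E : ℝ, ∀ s t : ℝ, q (o + s • a + t • b)
      = A * s ^ 2 + B * t ^ 2 + C * (s * t) + D * s + E * t + q o := by
  obtain ⟨A, B, C, D, E, F, G, H, I, h⟩ := hq.expand o a b 0
  exact ⟨A, B, D, G, H, fun s t => by simpa using h s t 0⟩

theorem expand₁ {q : E3 → ℝ} (hq : IsQuad q) (o a : E3) :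
    ∃ A B : ℝ, ∀ s : ℝ, q (o + s • a) = A * s ^ 2 + B * s + q o := by
  obtain ⟨A, B, C, D, E, h⟩ := hq.expand₂ o a 0
  exact ⟨A, D, fun s => by simpa using h s 0⟩

/-- The differential of a quadratic function at `a`. -/
theorem exists_differential {q : E3 → ℝ} (hq : IsQuad q) (a : E3) :
    ∃ l : E3 →ₗ[ℝ] ℝ, ∃ M : E3 → ℝ, (∀ (y : E3) (s : ℝ), M (s • y) = s ^ 2 * M y) ∧
      ∀ y, q (a + y) = q a + l y + M y := by
  obtain ⟨M, l, c, h⟩ := hq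
  refine ⟨M a + M.flip a + l, fun y => M y y, fun y s => by simp; ring, fun y => ?_⟩
  simp [h]; ring

end IsQuad

/-- A plane section of `K`, the plane being `⟪n, x⟫ = c`, whose boundary is cut out by the strictly
convex quadratic function `e`. -/
structure EllSection (K : Set E3) where
  /-- a normal vector of the plane -/
  n : E3
  /-- the height of the plane -/
  c : ℝ
  /-- an equation of the elliptic section -/
  e : E3 → ℝ
  isQuad : IsQuad e
  convex : ∀ u, u ≠ 0 → ⟪n, u⟫ = 0 → ∀ x, 2 * e x < e (x + u) + e (x - u)
  mem_interior : ∀ x, ⟪n, x⟫ = c → (x ∈ interior K ↔ e x < 0)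
  mem_frontier : ∀ x, ⟪n, x⟫ = c → (x ∈ frontier K ↔ e x = 0)

/-- `q` is a positive multiple of the equation of the section `S` on its plane. -/
def GoodFor {K : Set E3} (q : E3 → ℝ) (S : EllSection K) : Prop :=
  ∃ k : ℝ, 0 < k ∧ ∀ x, ⟪S.n, x⟫ = S.c → q x = k * S.e x

/-- From an interior point of a bounded set, every ray meets the boundary. -/
theorem exists_pos_mem_frontier (hK : IsCompact K) {o u : E3} (ho : o ∈ interior K) (hu : u ≠ 0) :
    ∃ t : ℝ, 0 < t ∧ o + t • u ∈ frontier K := by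
  obtain ⟨R, hR⟩ := hK.isBounded.exists_norm_le
  have hu' : 0 < ‖u‖ := norm_pos_iff.mpr hu
  obtain ⟨T, hT0, hT⟩ : ∃ T : ℝ, 0 ≤ T ∧ o + T • u ∉ K := by
    refine ⟨(|R| + ‖o‖ + 1) / ‖u‖, by positivity, fun h => ?_⟩
    have h1 := hR _ h
    have h2 : ‖((|R| + ‖o‖ + 1) / ‖u‖) • u‖ = |R| + ‖o‖ + 1 := by
      rw [norm_smul, Real.norm_of_nonneg (by positivity)]; field_simp
    have h3 := norm_sub_norm_le (((|R| + ‖o‖ + 1) / ‖u‖) • u) (-o)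
    rw [norm_neg, h2, sub_neg_eq_add, add_comm _ o] at h3
    linarith [le_abs_self R]
  have hpre : IsPreconnected ((fun t : ℝ => o + t • u) '' Set.Icc 0 T) :=
    isPreconnected_Icc.image _ (by fun_prop)
  obtain ⟨t, ht, hx⟩ : ∃ t ∈ Set.Icc 0 T, o + t • u ∈ frontier K := by
    by_contra! hno
    obtain ⟨x, -, hx, hx'⟩ := hpre (interior K) Kᶜ isOpen_interior hK.isClosed.isOpen_compl
      (by
        rintro _ ⟨t, ht, rfl⟩
        by_cases h : o + t • u ∈ K
        · by_contra h'
          exact hno t ht ⟨subset_closure h, fun h'' => h' (Or.inl h'')⟩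
        · exact Or.inr h)
      ⟨o, ⟨0, ⟨le_rfl, hT0⟩, by simp⟩, ho⟩ ⟨_, ⟨T, ⟨hT0, le_rfl⟩, rfl⟩, hT⟩
    exact hx' (interior_subset hx)
  refine ⟨t, lt_of_le_of_ne ht.1 ?_, hx⟩
  rintro rfl
  simp only [zero_smul, add_zero] at hx
  exact hx.2 ho

/-- A quadratic polynomial with negative constant term which vanishes at points of both signs is
determined up to a factor by its roots. -/
theorem eq_mul_of_common_roots {A B C A' B' C' s t : ℝ} (hs : s < 0) (ht : 0 < t)
    (h1 : A * s ^ 2 + B * s + C = 0) (h2 : A * t ^ 2 + B * t + C = 0)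
    (h1' : A' * s ^ 2 + B' * s + C' = 0) (h2' : A' * t ^ 2 + B' * t + C' = 0) (r : ℝ) :
    (A' * r ^ 2 + B' * r + C') * C = (A * r ^ 2 + B * r + C) * C' := by
  have e1 : (A' * C - A * C') * s + (B' * C - B * C') = 0 :=
    (mul_eq_zero.mp (by linear_combination C * h1' - C' * h1 :
      s * ((A' * C - A * C') * s + (B' * C - B * C')) = 0)).resolve_left hs.ne
  have e2 : (A' * C - A * C') * t + (B' * C - B * C') = 0 :=
    (mul_eq_zero.mp (by linear_combination C * h2' - C' * h2 :
      t * ((A' * C - A * C') * t + (B' * C - B * C')) = 0)).resolve_left ht.ne'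
  have e3 : A' * C - A * C' = 0 :=
    (mul_eq_zero.mp (by linear_combination e2 - e1 :
      (t - s) * (A' * C - A * C') = 0)).resolve_left (by linarith)
  have e4 : B' * C - B * C' = 0 := by rw [e3] at e1; linarith
  linear_combination r ^ 2 * e3 + r * e4

namespace EllSection

theorem inner_add {S : EllSection K} {o d : E3} (ho : ⟪S.n, o⟫ = S.c) (hd : ⟪S.n, d⟫ = 0) :
    ⟪S.n, o + d⟫ = S.c := by
  rw [_root_.inner_add_right, ho, hd, add_zero]

theorem inner_add_smul {S : EllSection K} {o d : E3} (ho : ⟪S.n, o⟫ = S.c) (hd : ⟪S.n, d⟫ = 0)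
    (t : ℝ) : ⟪S.n, o + t • d⟫ = S.c :=
  inner_add ho (by rw [inner_smul_right, hd, mul_zero])

/-- Two sections sharing a chord have proportional equations along it. -/
theorem proportional_on_line (hK : IsCompact K) {S S' : EllSection K} {o d : E3}
    (hS : ⟪S.n, o⟫ = S.c) (hS' : ⟪S'.n, o⟫ = S'.c) (ho : o ∈ interior K)
    (hd : ⟪S.n, d⟫ = 0) (hd' : ⟪S'.n, d⟫ = 0) (t : ℝ) :
    S'.e (o + t • d) * S.e o = S.e (o + t • d) * S'.e o := by
  rcases eq_or_ne d 0 with rfl | hd0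
  · simp [mul_comm]
  obtain ⟨t₁, ht₁, h₁⟩ := exists_pos_mem_frontier hK ho hd0
  obtain ⟨t₂, ht₂, h₂⟩ := exists_pos_mem_frontier hK ho (neg_ne_zero.mpr hd0)
  rw [smul_neg, ← neg_smul] at h₂
  obtain ⟨A, B, h⟩ := S.isQuad.expand₁ o d
  obtain ⟨A', B', h'⟩ := S'.isQuad.expand₁ o d
  rw [h, h']
  refine eq_mul_of_common_roots (neg_lt_zero.mpr ht₂) ht₁ ?_ ?_ ?_ ?_ t
  · rw [← h, ← S.mem_frontier _ (inner_add_smul hS hd _)]; exact h₂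
  · rw [← h, ← S.mem_frontier _ (inner_add_smul hS hd _)]; exact h₁
  · rw [← h', ← S'.mem_frontier _ (inner_add_smul hS' hd' _)]; exact h₂
  · rw [← h', ← S'.mem_frontier _ (inner_add_smul hS' hd' _)]; exact h₁

end EllSection

open EllSection

theorem GoodFor.on_line (hK : IsCompact K) {q : E3 → ℝ} {A P : EllSection K} (hA : GoodFor q A)
    {o d : E3} (hoA : ⟪A.n, o⟫ = A.c) (hoP : ⟪P.n, o⟫ = P.c) (ho : o ∈ interior K)
    (hdA : ⟪A.n, d⟫ = 0) (hdP : ⟪P.n, d⟫ = 0) (t : ℝ) :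
    q (o + t • d) * P.e o = P.e (o + t • d) * q o := by
  obtain ⟨k, -, h⟩ := hA
  rw [h _ (inner_add_smul hoA hdA t), h o hoA]
  linear_combination k * proportional_on_line hK hoP hoA ho hdP hdA t

theorem GoodFor.neg {q : E3 → ℝ} {A : EllSection K} (hA : GoodFor q A)
    {o : E3} (hoA : ⟪A.n, o⟫ = A.c) (ho : o ∈ interior K) : q o < 0 := by
  obtain ⟨k, hk, h⟩ := hA
  rw [h o hoA]
  exact mul_neg_of_pos_of_neg hk ((A.mem_interior o hoA).mp ho)

/-- If `q` fits two sections `A` and `B` then on a third transversal section it differs from a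
multiple of the equation by a multiple of the product of the two planes. -/
theorem GoodFor.exists_pencil (hK : IsCompact K) {q : E3 → ℝ} (hq : IsQuad q)
    {A B P : EllSection K} (hA : GoodFor q A) (hB : GoodFor q B) {o : E3}
    (hoA : ⟪A.n, o⟫ = A.c) (hoB : ⟪B.n, o⟫ = B.c) (hoP : ⟪P.n, o⟫ = P.c) (ho : o ∈ interior K)
    (hdet : ⟪P.n, cross3 A.n B.n⟫ ≠ 0) :
    ∃ k m : ℝ, 0 < k ∧ k * P.e o = q o ∧ ∀ x, ⟪P.n, x⟫ = P.c →
      q x = k * P.e x + m * ((⟪A.n, x⟫ - A.c) * (⟪B.n, x⟫ - B.c)) := by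
  set D := ⟪P.n, cross3 A.n B.n⟫ with hD
  have hPo := (P.mem_interior o hoP).mp ho
  have hqo := hA.neg hoA ho
  have hk : q o / P.e o * P.e o = q o := div_mul_cancel₀ _ hPo.ne
  set k := q o / P.e o with hkdef
  obtain ⟨X, Y, Z, V, W, hr⟩ := (hq.sub (P.isQuad.const_mul k)).expand₂ o (cross3 B.n P.n)
    (cross3 P.n A.n)
  rw [hk, sub_self] at hr
  have hb : ∀ s : ℝ, X * s ^ 2 + V * s = 0 := by
    intro s
    have h1 := hr s 0
    have h2 := hB.on_line hK hoB hoP ho (inner_left_cross3 B.n P.n) (inner_right_cross3 B.n P.n) s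
    rw [zero_smul, add_zero, ← hk, mul_comm k, ← mul_assoc] at *
    have h3 : q (o + s • cross3 B.n P.n) = P.e (o + s • cross3 B.n P.n) * k := by
      apply mul_right_cancel₀ hPo.ne; linarith
    linarith
  have ha : ∀ s : ℝ, Y * s ^ 2 + W * s = 0 := by
    intro s
    have h1 := hr 0 s
    have h2 := hA.on_line hK hoA hoP ho (inner_right_cross3 P.n A.n) (inner_left_cross3 P.n A.n) s
    rw [zero_smul, add_zero, ← hk, mul_comm k, ← mul_assoc] at *
    have h3 : q (o + s • cross3 P.n A.n) = P.e (o + s • cross3 P.n A.n) * k := by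
      apply mul_right_cancel₀ hPo.ne; linarith
    linarith
  refine ⟨k, Z / D ^ 2, div_pos_of_neg_of_neg hqo hPo, hk, fun x hx => ?_⟩
  have hx0 : ⟪P.n, x - o⟫ = 0 := by rw [inner_sub_right, hx, hoP, sub_self]
  have hexp := cross3_expansion P.n A.n B.n (x - o)
  rw [← hD, hx0, zero_smul, zero_add, inner_sub_right, inner_sub_right, hoA, hoB] at hexp
  have hxe : x = o + ((⟪A.n, x⟫ - A.c) / D) • cross3 B.n P.n
      + ((⟪B.n, x⟫ - B.c) / D) • cross3 P.n A.n := by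
    have : x - o = D⁻¹ • (D • (x - o)) := by rw [inv_smul_smul₀ hdet]
    rw [hexp, smul_add, smul_smul, smul_smul, ← div_eq_inv_mul, ← div_eq_inv_mul] at this
    rw [add_assoc, ← this]; abel
  have h1 := hr ((⟪A.n, x⟫ - A.c) / D) ((⟪B.n, x⟫ - B.c) / D)
  rw [← hxe] at h1
  have h2 := hb ((⟪A.n, x⟫ - A.c) / D)
  have h3 := ha ((⟪B.n, x⟫ - B.c) / D)
  have h4 : Z / D ^ 2 * ((⟪A.n, x⟫ - A.c) * (⟪B.n, x⟫ - B.c))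
    = Z * ((⟪A.n, x⟫ - A.c) / D * ((⟪B.n, x⟫ - B.c) / D)) := by field_simp
  rw [h4]
  linarith

/-- On the plane of a section, the differential of its equation at a boundary point is a positive
multiple of every supporting functional. -/
theorem EllSection.differential_eq (P : EllSection K) {a o : E3} (ha : ⟪P.n, a⟫ = P.c)
    (hfr : a ∈ frontier K) (hoP : ⟪P.n, o⟫ = P.c) (ho : o ∈ interior K) (f : StrongDual ℝ E3)
    (hf : ∀ x ∈ interior K, f x < f a) :
    ∃ k : ℝ, 0 < k ∧ ∀ y, ⟪P.n, y⟫ = 0 → P.e (a + y) - P.e (a - y) = k * f y := by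
  obtain ⟨l, M, hM, hl⟩ := P.isQuad.exists_differential a
  have hea : P.e a = 0 := (P.mem_frontier a ha).mp hfr
  have hMneg (y : E3) : M (-y) = M y := by simpa using hM y (-1)
  have hdiff (y : E3) : P.e (a + y) - P.e (a - y) = 2 * l y := by
    rw [sub_eq_add_neg a, hl, hl, hMneg, map_neg]; ring
  have hneg (y : E3) (hy : ⟪P.n, y⟫ = 0) (h : l y < 0) : f y < 0 := by
    have hs : ∃ s : ℝ, 0 < s ∧ s * |M y| < -l y := by
      refine ⟨-l y / (|M y| + 1), by have := abs_nonneg (M y); apply div_pos <;> linarith, ?_⟩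
      rw [div_mul_eq_mul_div, div_lt_iff₀ (by positivity)]
      nlinarith [abs_nonneg (M y)]
    obtain ⟨s, hs0, hs⟩ := hs
    have h1 : P.e (a + s • y) < 0 := by
      rw [hl, hea, hM, map_smul, smul_eq_mul]
      nlinarith [mul_le_mul_of_nonneg_left (le_abs_self (M y)) hs0.le]
    have h2 := hf _ ((P.mem_interior _ (inner_add_smul ha hy s)).mpr h1)
    rw [map_add, map_smul, smul_eq_mul] at h2
    nlinarith
  have hu : ⟪P.n, o - a⟫ = 0 := by rw [inner_sub_right, ha, hoP, sub_self]
  have hne : o - a ≠ 0 := by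
    rw [sub_ne_zero]; rintro rfl; exact hfr.2 ho
  have hlu : l (o - a) < 0 := by
    have h1 := P.convex (o - a) hne hu a
    have h2 := hdiff (o - a)
    have h3 := (P.mem_interior o hoP).mp ho
    rw [add_sub_cancel] at h1 h2
    linarith
  have hfu : f (o - a) < 0 := hneg _ hu hlu
  have hzero_le (y : E3) (hy : ⟪P.n, y⟫ = 0) (h : l y = 0) : f y ≤ 0 := by
    refine le_of_forall_pos_lt_add fun ε hε => ?_
    have hlt : 0 < ε / -f (o - a) := div_pos hε (by linarith)
    have h1 := hneg (y + (ε / -f (o - a)) • (o - a))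
      (by rw [inner_add_right, inner_smul_right, hy, hu]; ring)
      (by rw [map_add, map_smul, h, smul_eq_mul]; nlinarith)
    rw [map_add, map_smul, smul_eq_mul] at h1
    have h2 : ε / -f (o - a) * f (o - a) = -ε := by
      rw [div_mul_eq_mul_div, div_eq_iff (by linarith)]; ring
    linarith
  have hzero (y : E3) (hy : ⟪P.n, y⟫ = 0) (h : l y = 0) : f y = 0 := by
    have h1 := hzero_le y hy h
    have h2 := hzero_le (-y) (by rw [inner_neg_right, hy, neg_zero]) (by rw [map_neg, h, neg_zero])
    rw [map_neg] at h2
    linarith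
  refine ⟨2 * (l (o - a) / f (o - a)), by have := div_pos_of_neg_of_neg hlu hfu; linarith,
    fun y hy => ?_⟩
  have h1 := hzero (y - (l y / l (o - a)) • (o - a))
    (by rw [inner_sub_right, inner_smul_right, hy, hu]; ring)
    (by rw [map_sub, map_smul, smul_eq_mul, div_mul_cancel₀ _ hlu.ne, sub_self])
  rw [map_sub, map_smul, smul_eq_mul] at h1
  rw [hdiff, show f y = l y / l (o - a) * f (o - a) by linarith]
  have := hlu.ne; have := hfu.ne
  field_simp

/-- Two sections determine the tangent plane at their common boundary points. -/
theorem GoodFor.tangency (hK : IsCompact K) (hconv : Convex ℝ K) {q : E3 → ℝ} (hq : IsQuad q)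
    {A B : EllSection K} (P : EllSection K) (hA : GoodFor q A) (hB : GoodFor q B)
    (hAB : cross3 A.n B.n ≠ 0) {o u : E3} (hoA : ⟪A.n, o⟫ = A.c) (hoB : ⟪B.n, o⟫ = B.c)
    (hoP : ⟪P.n, o⟫ = P.c) (ho : o ∈ interior K) (hu : u ≠ 0) (huA : ⟪A.n, u⟫ = 0)
    (huB : ⟪B.n, u⟫ = 0) (huP : ⟪P.n, u⟫ = 0) :
    ∃ t : ℝ, 0 < t ∧ o + t • u ∈ frontier K ∧ ∀ y, ⟪P.n, y⟫ = 0 →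
      (q (o + t • u + y) - q (o + t • u - y)) * P.e o
        = (P.e (o + t • u + y) - P.e (o + t • u - y)) * q o := by
  obtain ⟨t, ht, hfr⟩ := exists_pos_mem_frontier hK ho hu
  refine ⟨t, ht, hfr, ?_⟩
  set a := o + t • u with ha
  obtain ⟨f, hf⟩ := geometric_hahn_banach_open_point hconv.interior isOpen_interior hfr.2
  have haA : ⟪A.n, a⟫ = A.c := inner_add_smul hoA huA t
  have haB : ⟪B.n, a⟫ = B.c := inner_add_smul hoB huB t
  have haP : ⟪P.n, a⟫ = P.c := inner_add_smul hoP huP t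
  obtain ⟨κA, -, hκA⟩ := A.differential_eq haA hfr hoA ho f hf
  obtain ⟨κB, -, hκB⟩ := B.differential_eq haB hfr hoB ho f hf
  obtain ⟨κP, -, hκP⟩ := P.differential_eq haP hfr hoP ho f hf
  have hfu : 0 < t * f u := by
    have := hf o ho
    rw [ha, map_add, map_smul, smul_eq_mul] at this
    linarith
  obtain ⟨l, M, hM, hl⟩ := hq.exists_differential a
  have hdiff (y : E3) : q (a + y) - q (a - y) = 2 * l y := by
    have : M (-y) = M y := by simpa using hM y (-1)
    rw [sub_eq_add_neg a, hl, hl, this, map_neg]; ring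
  have hline := hA.on_line hK hoA hoP ho huA huP
  obtain ⟨kA, -, hqA⟩ := hA
  obtain ⟨kB, -, hqB⟩ := hB
  have hlA (y : E3) (hy : ⟪A.n, y⟫ = 0) : 2 * l y = kA * κA * f y := by
    rw [← hdiff, hqA _ (inner_add haA hy), sub_eq_add_neg a,
      hqA _ (inner_add haA (by rw [inner_neg_right, hy, neg_zero])), mul_assoc, ← hκA y hy,
      sub_eq_add_neg a]; ring
  have hlB (y : E3) (hy : ⟪B.n, y⟫ = 0) : 2 * l y = kB * κB * f y := by
    rw [← hdiff, hqB _ (inner_add haB hy), sub_eq_add_neg a,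
      hqB _ (inner_add haB (by rw [inner_neg_right, hy, neg_zero])), mul_assoc, ← hκB y hy,
      sub_eq_add_neg a]; ring
  have hρ : kA * κA = kB * κB := by
    have h1 := hlA u huA
    rw [hlB u huB] at h1
    have : f u ≠ 0 := by rintro h; rw [h] at hfu; simp at hfu
    exact (mul_right_cancel₀ this h1).symm
  have hall (y : E3) : 2 * l y = kA * κA * f y := by
    set c := cross3 A.n B.n with hc
    have hcc : ⟪c, c⟫ ≠ 0 := by simpa using hAB
    have hz : ⟪B.n, cross3 c A.n⟫ = ⟪c, c⟫ := by
      rw [← inner_cross3_rotate, ← inner_cross3_rotate]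
    have h1 := hlA ((⟪B.n, y⟫ / ⟪c, c⟫) • cross3 c A.n)
      (by rw [inner_smul_right, inner_right_cross3, mul_zero])
    have h2 := hlB (y - (⟪B.n, y⟫ / ⟪c, c⟫) • cross3 c A.n)
      (by rw [inner_sub_right, inner_smul_right, hz, div_mul_cancel₀ _ hcc, sub_self])
    rw [← hρ] at h2
    rw [map_sub, map_sub] at h2
    linarith
  have hmatch : kA * κA * P.e o = κP * q o := by
    have h1 : a + t • u = o + (2 * t) • u := by rw [ha, two_mul, add_smul]; abel
    have h2 : a - t • u = o + (0 : ℝ) • u := by rw [ha]; simp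
    have h3 := hline (2 * t)
    have h4 := hline 0
    rw [← h1] at h3
    rw [← h2] at h4
    have h5 := hdiff (t • u)
    rw [hall] at h5
    have h6 := hκP (t • u) (by rw [inner_smul_right, huP, mul_zero])
    rw [map_smul, smul_eq_mul] at h5 h6
    apply mul_left_cancel₀ hfu.ne'
    linear_combination h3 - h4 - P.e o * h5 + q o * h6
  intro y hy
  rw [hdiff, hall, hκP y hy]
  linear_combination f y * hmatch

/-- Dual vectors: the values of three independent functionals can be prescribed. -/
theorem exists_inner_eq_of_det_ne_zero {a b c : E3} (h : ⟪a, cross3 b c⟫ ≠ 0) :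
    ∃ y : E3, ⟪a, y⟫ = 1 ∧ ⟪b, y⟫ = 0 ∧ ⟪c, y⟫ = 0 := by
  refine ⟨⟪a, cross3 b c⟫⁻¹ • cross3 b c, ?_, ?_, ?_⟩
  · rw [inner_smul_right, inv_mul_cancel₀ h]
  · rw [inner_smul_right, inner_left_cross3, mul_zero]
  · rw [inner_smul_right, inner_right_cross3, mul_zero]

/-- A section through a point of the line `A ∩ B` inside `K` fits any quadratic function
fitting `A`, `B` and a transversal section `F`. -/
theorem GoodFor.of_concurrent (hK : IsCompact K) (hconv : Convex ℝ K) {q : E3 → ℝ} (hq : IsQuad q)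
    {A B F P : EllSection K} (hA : GoodFor q A) (hB : GoodFor q B) (hF : GoodFor q F)
    (hdet : ⟪A.n, cross3 B.n F.n⟫ ≠ 0)
    (hint : ∀ x, ⟪A.n, x⟫ = A.c → ⟪B.n, x⟫ = B.c → ⟪F.n, x⟫ = F.c → x ∈ interior K)
    {o : E3} (hoP : ⟪P.n, o⟫ = P.c) (hoB : ⟪B.n, o⟫ = B.c) (hoF : ⟪F.n, o⟫ = F.c)
    (ho : o ∈ interior K) (hdetP : ⟪P.n, cross3 B.n F.n⟫ ≠ 0)
    {p : E3} (hpP : ⟪P.n, p⟫ = P.c) (hpA : ⟪A.n, p⟫ = A.c) (hpB : ⟪B.n, p⟫ = B.c)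
    (hp : p ∈ interior K) : GoodFor q P := by
  obtain ⟨k, m, hk, -, h⟩ := hB.exists_pencil hK hq hF hoB hoF hoP ho hdetP
  suffices hm : m = 0 from ⟨k, hk, fun x hx => by rw [h x hx, hm]; ring⟩
  by_contra hm
  have hqp : q p = k * P.e p := by rw [h p hpP, hpB]; ring
  have hPp := (P.mem_interior p hpP).mp hp
  have hderiv {a : E3} (ha : ⟪P.n, a⟫ = P.c) {y : E3} (hy : ⟪P.n, y⟫ = 0)
      (hd : (q (a + y) - q (a - y)) * P.e p = (P.e (a + y) - P.e (a - y)) * q p) :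
      (⟪B.n, a⟫ - B.c) * ⟪F.n, y⟫ + (⟪F.n, a⟫ - F.c) * ⟪B.n, y⟫ = 0 := by
    rw [h _ (inner_add ha hy), sub_eq_add_neg a,
      h _ (inner_add ha (by rw [inner_neg_right, hy, neg_zero])), hqp] at hd
    simp only [inner_add_right, inner_neg_right] at hd
    have : m * P.e p ≠ 0 := mul_ne_zero hm hPp.ne
    apply mul_left_cancel₀ this
    linear_combination hd / 2
  obtain ⟨u, hu, huP, huA⟩ := exists_ne_zero_inner_eq_zero P.n A.n
  have hzero (t : ℝ) : t * ⟪B.n, u⟫ * (⟪F.n, p⟫ - F.c + t * ⟪F.n, u⟫) = 0 := by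
    have h1 := hA.on_line hK hpA hpP hp huA huP t
    rw [h _ (inner_add_smul hpP huP t), hqp] at h1
    simp only [inner_add_right, inner_smul_right, hpB] at h1
    have : m * P.e p ≠ 0 := mul_ne_zero hm hPp.ne
    apply mul_left_cancel₀ this
    linear_combination h1
  rcases eq_or_ne ⟪B.n, u⟫ 0 with huB | huB
  · have hAB : cross3 A.n B.n ≠ 0 := by
      intro h0
      rw [inner_cross3_rotate, inner_cross3_rotate, h0] at hdet
      simp at hdet
    obtain ⟨t, ht, hfr, hd⟩ := hA.tangency hK hconv hq P hB hAB hpA hpB hpP hp hu huA huB huP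
    obtain ⟨y, hy, hyF, hyP⟩ := exists_inner_eq_of_det_ne_zero
      (a := B.n) (b := F.n) (c := P.n) (by rwa [← inner_cross3_rotate])
    have h1 := hderiv (inner_add_smul hpP huP t) hyP (hd y hyP)
    rw [hyF, hy] at h1
    exact hfr.2 (hint _ (inner_add_smul hpA huA t) (inner_add_smul hpB huB t) (by linarith))
  · have h1 := (mul_eq_zero.mp (hzero 1)).resolve_left (by simpa using huB)
    have h2 := (mul_eq_zero.mp (hzero (-1))).resolve_left (by simpa using huB)
    have hpF : ⟪F.n, p⟫ = F.c := by linarith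
    have huF : ⟪F.n, u⟫ = 0 := by linarith
    have hAF : cross3 F.n A.n ≠ 0 := by
      intro h0
      rw [inner_cross3_rotate, h0] at hdet
      simp at hdet
    obtain ⟨t, ht, hfr, hd⟩ := hF.tangency hK hconv hq P hA hAF hpF hpA hpP hp hu huF huA huP
    obtain ⟨y, hy, hyP, hyB⟩ := exists_inner_eq_of_det_ne_zero
      (a := F.n) (b := P.n) (c := B.n) (by rwa [inner_cross3_rotate])
    have h3 := hderiv (inner_add_smul hpP huP t) hyP (hd y hyP)
    rw [hyB, hy] at h3
    exact hfr.2 (hint _ (inner_add_smul hpA huA t) (by linarith) (inner_add_smul hpF huF t))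

/-- Two sections through a line which misses `A ∩ B` fit any quadratic function
fitting `A`, `B` and a transversal section `F`. -/
theorem GoodFor.of_skew (hK : IsCompact K) {q : E3 → ℝ} (hq : IsQuad q)
    {A B F P P' : EllSection K} (hA : GoodFor q A) (hB : GoodFor q B) (hF : GoodFor q F)
    {o o' : E3} (hoP : ⟪P.n, o⟫ = P.c) (hoB : ⟪B.n, o⟫ = B.c) (hoF : ⟪F.n, o⟫ = F.c)
    (ho : o ∈ interior K) (hdet : ⟪P.n, cross3 B.n F.n⟫ ≠ 0)
    (hoP' : ⟪P'.n, o'⟫ = P'.c) (hoA' : ⟪A.n, o'⟫ = A.c) (hoF' : ⟪F.n, o'⟫ = F.c)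
    (ho' : o' ∈ interior K) (hdet' : ⟪P'.n, cross3 A.n F.n⟫ ≠ 0)
    {p w : E3} (hpP : ⟪P.n, p⟫ = P.c) (hpP' : ⟪P'.n, p⟫ = P'.c) (hpF : ⟪F.n, p⟫ = F.c)
    (hp : p ∈ interior K) (hwP : ⟪P.n, w⟫ = 0) (hwP' : ⟪P'.n, w⟫ = 0) (hwF : ⟪F.n, w⟫ ≠ 0)
    (hw : ⟪A.n, w⟫ ≠ 0 ∨ ⟪B.n, w⟫ ≠ 0)
    (hskew : ∀ t : ℝ, ⟪A.n, p + t • w⟫ = A.c → ⟪B.n, p + t • w⟫ ≠ B.c) :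
    GoodFor q P ∧ GoodFor q P' := by
  obtain ⟨k, m, hk, -, h⟩ := hB.exists_pencil hK hq hF hoB hoF hoP ho hdet
  obtain ⟨k', m', hk', -, h'⟩ := hA.exists_pencil hK hq hF hoA' hoF' hoP' ho' hdet'
  have hPp := (P.mem_interior p hpP).mp hp
  have hqp : q p = k * P.e p := by rw [h p hpP, hpF]; ring
  have hqp' : q p = k' * P'.e p := by rw [h' p hpP', hpF]; ring
  have hline (t : ℝ) : k' * P'.e (p + t • w) = k * P.e (p + t • w) := by
    have := proportional_on_line hK hpP hpP' hp hwP hwP' t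
    apply mul_right_cancel₀ hPp.ne
    linear_combination k' * this - P.e (p + t • w) * (hqp' - hqp)
  have hlin (t : ℝ) (ht : t ≠ 0) : m * (⟪B.n, p⟫ - B.c + t * ⟪B.n, w⟫)
      = m' * (⟪A.n, p⟫ - A.c + t * ⟪A.n, w⟫) := by
    have h1 := h _ (inner_add_smul hpP hwP t)
    have h2 := h' _ (inner_add_smul hpP' hwP' t)
    have h3 := hline t
    simp only [inner_add_right, inner_smul_right, hpF] at h1 h2
    apply mul_right_cancel₀ (mul_ne_zero ht hwF)
    linear_combination h2 - h1 + h3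
  have hB1 : m * ⟪B.n, w⟫ = m' * ⟪A.n, w⟫ := by
    linear_combination (hlin 1 one_ne_zero - hlin (-1) (by norm_num)) / 2
  have hB0 : m * (⟪B.n, p⟫ - B.c) = m' * (⟪A.n, p⟫ - A.c) := by
    linear_combination (hlin 1 one_ne_zero + hlin (-1) (by norm_num)) / 2
  have hzero : m = 0 ∧ m' = 0 := by
    rcases hw with hw | hw
    · obtain ⟨s, hs⟩ : ∃ s, s * ⟪A.n, w⟫ = -(⟪A.n, p⟫ - A.c) :=
        ⟨_, div_mul_cancel₀ _ hw⟩
      have hm : m = 0 := by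
        by_contra hm
        refine hskew s (by rw [inner_add_right, inner_smul_right]; linarith) ?_
        rw [inner_add_right, inner_smul_right]
        apply mul_left_cancel₀ (mul_ne_zero hm hw)
        linear_combination ⟪A.n, w⟫ * hB0 + s * ⟪A.n, w⟫ * hB1 + m' * ⟪A.n, w⟫ * hs
      exact ⟨hm, (mul_eq_zero.mp (by rw [← hB1, hm, zero_mul])).resolve_right hw⟩
    · obtain ⟨s, hs⟩ : ∃ s, s * ⟪B.n, w⟫ = -(⟪B.n, p⟫ - B.c) :=
        ⟨_, div_mul_cancel₀ _ hw⟩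
      have hm : m' = 0 := by
        by_contra hm
        refine hskew s ?_ (by rw [inner_add_right, inner_smul_right]; linarith)
        rw [inner_add_right, inner_smul_right]
        apply mul_left_cancel₀ (mul_ne_zero hm hw)
        linear_combination -⟪B.n, w⟫ * hB0 - s * ⟪B.n, w⟫ * hB1 + m * ⟪B.n, w⟫ * hs
      exact ⟨(mul_eq_zero.mp (by rw [hB1, hm, zero_mul])).resolve_right hw, hm⟩
  exact ⟨⟨k, hk, fun x hx => by rw [h x hx, hzero.1]; ring⟩,
    ⟨k', hk', fun x hx => by rw [h' x hx, hzero.2]; ring⟩⟩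

theorem IsQuad.affine (n : E3) (c : ℝ) : IsQuad fun x => ⟪n, x⟫ - c :=
  ⟨0, innerₗ E3 n, -c, fun x => by simp; ring⟩

/-- The normalized coefficients of two sections agree along a common chord. -/
theorem EllSection.coeff_eq (hK : IsCompact K) {S S' : EllSection K} {o d : E3}
    (hS : ⟪S.n, o⟫ = S.c) (hS' : ⟪S'.n, o⟫ = S'.c) (ho : o ∈ interior K)
    (hd : ⟪S.n, d⟫ = 0) (hd' : ⟪S'.n, d⟫ = 0) {a b a' b' : ℝ}
    (h : ∀ t : ℝ, S.e (o + t • d) = a * t ^ 2 + b * t + S.e o)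
    (h' : ∀ t : ℝ, S'.e (o + t • d) = a' * t ^ 2 + b' * t + S'.e o) :
    (-S.e o)⁻¹ * a = (-S'.e o)⁻¹ * a' ∧ (-S.e o)⁻¹ * b = (-S'.e o)⁻¹ * b' := by
  have h0 := ((S.mem_interior o hS).mp ho).ne
  have h0' := ((S'.mem_interior o hS').mp ho).ne
  have h1 := proportional_on_line hK hS hS' ho hd hd' 1
  have h2 := proportional_on_line hK hS hS' ho hd hd' (-1)
  rw [h, h'] at h1 h2
  constructor <;> rw [inv_mul_eq_div, inv_mul_eq_div, div_eq_div_iff (by simpa) (by simpa)]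
  · linear_combination (h1 + h2) / 2
  · linear_combination (h1 - h2) / 2

/-- There is a quadratic function fitting three sections whose planes meet in one interior point. -/
theorem exists_goodFor_three (hK : IsCompact K) {A B C : EllSection K} {o : E3}
    (hA : ⟪A.n, o⟫ = A.c) (hB : ⟪B.n, o⟫ = B.c) (hC : ⟪C.n, o⟫ = C.c) (ho : o ∈ interior K)
    (hdet : ⟪A.n, cross3 B.n C.n⟫ ≠ 0) :
    ∃ q, IsQuad q ∧ GoodFor q A ∧ GoodFor q B ∧ GoodFor q C := by
  set D := ⟪A.n, cross3 B.n C.n⟫ with hD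
  set a := D⁻¹ • cross3 B.n C.n with ha
  set b := D⁻¹ • cross3 C.n A.n with hb
  set c := D⁻¹ • cross3 A.n B.n with hc
  have hBa : ⟪B.n, a⟫ = 0 := by rw [ha, inner_smul_right, inner_left_cross3, mul_zero]
  have hCa : ⟪C.n, a⟫ = 0 := by rw [ha, inner_smul_right, inner_right_cross3, mul_zero]
  have hCb : ⟪C.n, b⟫ = 0 := by rw [hb, inner_smul_right, inner_left_cross3, mul_zero]
  have hAb : ⟪A.n, b⟫ = 0 := by rw [hb, inner_smul_right, inner_right_cross3, mul_zero]
  have hAc : ⟪A.n, c⟫ = 0 := by rw [hc, inner_smul_right, inner_left_cross3, mul_zero]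
  have hBc : ⟪B.n, c⟫ = 0 := by rw [hc, inner_smul_right, inner_right_cross3, mul_zero]
  have hx (x : E3) : x = o + (⟪A.n, x⟫ - A.c) • a + (⟪B.n, x⟫ - B.c) • b
      + (⟪C.n, x⟫ - C.c) • c := by
    have hexp := cross3_expansion A.n B.n C.n (x - o)
    rw [← hD, inner_sub_right, inner_sub_right, inner_sub_right, hA, hB, hC] at hexp
    have h1 : x - o = D⁻¹ • (D • (x - o)) := by rw [inv_smul_smul₀ hdet]
    rw [hexp, smul_add, smul_add, smul_comm D⁻¹, smul_comm D⁻¹, smul_comm D⁻¹] at h1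
    rw [add_assoc, add_assoc, ← add_assoc (_ • a), ← h1]
    abel
  have hA0 := (A.mem_interior o hA).mp ho
  have hB0 := (B.mem_interior o hB).mp ho
  have hC0 := (C.mem_interior o hC).mp ho
  have hAi : (-A.e o)⁻¹ * A.e o = -1 := by rw [inv_neg, neg_mul, inv_mul_cancel₀ hA0.ne]
  have hBi : (-B.e o)⁻¹ * B.e o = -1 := by rw [inv_neg, neg_mul, inv_mul_cancel₀ hB0.ne]
  have hCi : (-C.e o)⁻¹ * C.e o = -1 := by rw [inv_neg, neg_mul, inv_mul_cancel₀ hC0.ne]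
  obtain ⟨A₁, A₂, A₃, A₄, A₅, A₆, A₇, A₈, A₉, hAe⟩ := A.isQuad.expand o a b c
  obtain ⟨B₁, B₂, B₃, B₄, B₅, B₆, B₇, B₈, B₉, hBe⟩ := B.isQuad.expand o a b c
  obtain ⟨C₁, C₂, C₃, C₄, C₅, C₆, C₇, C₈, C₉, hCe⟩ := C.isQuad.expand o a b c
  obtain ⟨ha₁, ha₂⟩ := B.coeff_eq hK hB hC ho hBa hCa
    (fun t => by simpa using hBe t 0 0) (fun t => by simpa using hCe t 0 0)
  obtain ⟨hb₁, hb₂⟩ := C.coeff_eq hK hC hA ho hCb hAb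
    (fun t => by simpa using hCe 0 t 0) (fun t => by simpa using hAe 0 t 0)
  obtain ⟨hc₁, hc₂⟩ := A.coeff_eq hK hA hB ho hAc hBc
    (fun t => by simpa using hAe 0 0 t) (fun t => by simpa using hBe 0 0 t)
  set α := (-A.e o)⁻¹ with hα
  set β := (-B.e o)⁻¹ with hβ
  set γ := (-C.e o)⁻¹ with hγ
  refine ⟨fun x => β * B₁ * ((⟪A.n, x⟫ - A.c) * (⟪A.n, x⟫ - A.c))
      + γ * C₂ * ((⟪B.n, x⟫ - B.c) * (⟪B.n, x⟫ - B.c))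
      + α * A₃ * ((⟪C.n, x⟫ - C.c) * (⟪C.n, x⟫ - C.c))
      + γ * C₄ * ((⟪A.n, x⟫ - A.c) * (⟪B.n, x⟫ - B.c))
      + α * A₅ * ((⟪B.n, x⟫ - B.c) * (⟪C.n, x⟫ - C.c))
      + β * B₆ * ((⟪A.n, x⟫ - A.c) * (⟪C.n, x⟫ - C.c))
      + β * B₇ * (⟪A.n, x⟫ - A.c) + γ * C₈ * (⟪B.n, x⟫ - B.c) + α * A₉ * (⟪C.n, x⟫ - C.c) + -1,
    ?_, ⟨α, inv_pos.mpr (by linarith), fun x hxA => ?_⟩,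
    ⟨β, inv_pos.mpr (by linarith), fun x hxB => ?_⟩,
    ⟨γ, inv_pos.mpr (by linarith), fun x hxC => ?_⟩⟩
  · refine IsQuad.add (IsQuad.add (IsQuad.add (IsQuad.add (IsQuad.add (IsQuad.add (IsQuad.add
      (IsQuad.add (IsQuad.add ?_ ?_) ?_) ?_) ?_) ?_) ?_) ?_) ?_) (IsQuad.const _)
    iterate 6 exact (IsQuad.mul_affine _ _ _ _).const_mul _
    iterate 3 exact (IsQuad.affine _ _).const_mul _
  · have h1 := hAe (⟪A.n, x⟫ - A.c) (⟪B.n, x⟫ - B.c) (⟪C.n, x⟫ - C.c)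
    rw [← hx] at h1
    beta_reduce
    rw [h1, hxA]
    linear_combination (⟪B.n, x⟫ - B.c) ^ 2 * hb₁ + (⟪B.n, x⟫ - B.c) * hb₂ - hAi
  · have h1 := hBe (⟪A.n, x⟫ - A.c) (⟪B.n, x⟫ - B.c) (⟪C.n, x⟫ - C.c)
    rw [← hx] at h1
    beta_reduce
    rw [h1, hxB]
    linear_combination (⟪C.n, x⟫ - C.c) ^ 2 * hc₁ + (⟪C.n, x⟫ - C.c) * hc₂ - hBi
  · have h1 := hCe (⟪A.n, x⟫ - A.c) (⟪B.n, x⟫ - B.c) (⟪C.n, x⟫ - C.c)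
    rw [← hx] at h1
    beta_reduce
    rw [h1, hxC]
    linear_combination (⟪A.n, x⟫ - A.c) ^ 2 * ha₁ + (⟪A.n, x⟫ - A.c) * ha₂ - hCi

/-- A quadratic function vanishing on two transversal planes is a multiple of their product. -/
theorem IsQuad.eq_mul_of_vanish {r : E3 → ℝ} (hr : IsQuad r) {a b o : E3}
    (hab : cross3 a b ≠ 0) (ha : ∀ x, ⟪a, x⟫ = ⟪a, o⟫ → r x = 0)
    (hb : ∀ x, ⟪b, x⟫ = ⟪b, o⟫ → r x = 0) :
    ∃ μ : ℝ, ∀ x, r x = μ * ((⟪a, x⟫ - ⟪a, o⟫) * (⟪b, x⟫ - ⟪b, o⟫)) := by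
  set c := cross3 a b with hc
  have hD : ⟪c, c⟫ ≠ 0 := by simpa using hab
  obtain ⟨A, B, C, D, E, F, G, H, I, h⟩ := hr.expand o (cross3 b c) (cross3 c a) c
  have h1 (t z : ℝ) : r (o + (0 : ℝ) • cross3 b c + t • cross3 c a + z • c) = 0 := by
    refine ha _ ?_
    simp [inner_add_right, inner_smul_right, inner_right_cross3, hc, inner_left_cross3]
  have h2 (s z : ℝ) : r (o + s • cross3 b c + (0 : ℝ) • cross3 c a + z • c) = 0 := by
    refine hb _ ?_
    simp [inner_add_right, inner_smul_right, inner_right_cross3, hc, inner_left_cross3]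
  refine ⟨D / ⟪c, c⟫ ^ 2, fun x => ?_⟩
  have hexp := cross3_expansion a b c (x - o)
  have hdet : ⟪a, cross3 b c⟫ = ⟪c, c⟫ := by rw [inner_cross3_rotate, inner_cross3_rotate]
  rw [hdet] at hexp
  have hx : x = o + (⟪a, x - o⟫ / ⟪c, c⟫) • cross3 b c + (⟪b, x - o⟫ / ⟪c, c⟫) • cross3 c a
      + (⟪c, x - o⟫ / ⟪c, c⟫) • c := by
    have h3 : x - o = ⟪c, c⟫⁻¹ • (⟪c, c⟫ • (x - o)) := by rw [inv_smul_smul₀ hD]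
    rw [hexp, smul_add, smul_add, smul_smul, smul_smul, smul_smul, ← div_eq_inv_mul,
      ← div_eq_inv_mul, ← div_eq_inv_mul] at h3
    rw [add_assoc, add_assoc, ← add_assoc (_ • _) (_ • _) (_ • _), ← h3]
    abel
  have e1 := h1 (⟪b, x - o⟫ / ⟪c, c⟫) (⟪c, x - o⟫ / ⟪c, c⟫)
  have e2 := h2 (⟪a, x - o⟫ / ⟪c, c⟫) (⟪c, x - o⟫ / ⟪c, c⟫)
  have e3 := h1 0 (⟪c, x - o⟫ / ⟪c, c⟫)
  have e4 := h (⟪a, x - o⟫ / ⟪c, c⟫) (⟪b, x - o⟫ / ⟪c, c⟫) (⟪c, x - o⟫ / ⟪c, c⟫)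
  rw [← hx] at e4
  rw [h] at e1 e2 e3
  have e5 : D / ⟪c, c⟫ ^ 2 * (⟪a, x - o⟫ * ⟪b, x - o⟫)
      = D * (⟪a, x - o⟫ / ⟪c, c⟫ * (⟪b, x - o⟫ / ⟪c, c⟫)) := by field_simp
  rw [← inner_sub_right, ← inner_sub_right, e5, e4]
  linear_combination e1 + e2 - e3

theorem eq_zero_of_forall_orthogonal {a b m : E3} (hab : cross3 a b ≠ 0)
    (ha : ∀ u, ⟪a, u⟫ = 0 → ⟪m, u⟫ = 0) (hb : ∀ u, ⟪b, u⟫ = 0 → ⟪m, u⟫ = 0) : m = 0 := by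
  have hD : ⟪cross3 a b, cross3 a b⟫ ≠ 0 := by simpa using hab
  have hexp := cross3_expansion a b (cross3 a b) m
  have hdet : ⟪a, cross3 b (cross3 a b)⟫ = ⟪cross3 a b, cross3 a b⟫ := by
    rw [inner_cross3_rotate, inner_cross3_rotate]
  have h1 := hb (cross3 b (cross3 a b)) (inner_left_cross3 _ _)
  have h2 := ha (cross3 (cross3 a b) a) (inner_right_cross3 _ _)
  have h3 := ha (cross3 a b) (inner_left_cross3 _ _)
  have h4 := congrArg (fun y => ⟪m, y⟫) hexp
  simp only [inner_add_right, inner_smul_right, h1, h2, h3, hdet] at h4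
  have h5 := (mul_eq_zero.mp (by linarith : _ * ⟪m, m⟫ = 0)).resolve_left hD
  exact inner_self_eq_zero.mp h5

/-- Two quadratic functions fitting two pairs of sections through two lines of different
directions are proportional. -/
theorem GoodFor.eq_const_mul {q q' : E3 → ℝ} (hq : IsQuad q) (hq' : IsQuad q')
    {A B P P' : EllSection K} (hA : GoodFor q A) (hB : GoodFor q B) (hA' : GoodFor q' A)
    (hB' : GoodFor q' B) {o : E3} (hoA : ⟪A.n, o⟫ = A.c) (hoB : ⟪B.n, o⟫ = B.c)
    (ho : o ∈ interior K) (hAB : cross3 A.n B.n ≠ 0)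
    (hP : GoodFor q P) (hP' : GoodFor q P') (hPq' : GoodFor q' P) (hPq'' : GoodFor q' P')
    (hPP : cross3 P.n P'.n ≠ 0) {p w : E3} (hpP : ⟪P.n, p⟫ = P.c) (hpP' : ⟪P'.n, p⟫ = P'.c)
    (hwP : ⟪P.n, w⟫ = 0) (hwP' : ⟪P'.n, w⟫ = 0) (hw : ⟪A.n, w⟫ ≠ 0 ∨ ⟪B.n, w⟫ ≠ 0) :
    ∃ κ : ℝ, 0 < κ ∧ ∀ x, q x = κ * q' x := by
  have hq0 := hA.neg hoA ho
  have hq0' := hA'.neg hoA ho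
  have hκ : q o = q o / q' o * q' o := (div_mul_cancel₀ _ hq0'.ne).symm
  have hκ0 : 0 < q o / q' o := div_pos_of_neg_of_neg hq0 hq0'
  set κ := q o / q' o
  refine ⟨κ, hκ0, ?_⟩
  have hvan {S : EllSection K} (h : GoodFor q S) (h' : GoodFor q' S) (hoS : ⟪S.n, o⟫ = S.c)
      (x : E3) (hx : ⟪S.n, x⟫ = ⟪S.n, o⟫) : q x - κ * q' x = 0 := by
    obtain ⟨k, -, h⟩ := h
    obtain ⟨k', -, h'⟩ := h'
    have hS := ((S.mem_interior o hoS).mp ho).ne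
    rw [h o hoS, h' o hoS] at hκ
    rw [hoS] at hx
    have : k = κ * k' := mul_right_cancel₀ hS (by linarith)
    rw [h x hx, h' x hx, this]; ring
  obtain ⟨μ, hμ⟩ := (hq.sub (hq'.const_mul κ)).eq_mul_of_vanish hAB (hvan hA hA' hoA)
    (hvan hB hB' hoB)
  suffices hμ0 : μ = 0 from fun x => by
    have := hμ x
    rw [hμ0, zero_mul] at this
    linarith
  by_contra hμ0
  have hform {S : EllSection K} (h : GoodFor q S) (h' : GoodFor q' S) (hpS : ⟪S.n, p⟫ = S.c)
      (u : E3) (hu : ⟪S.n, u⟫ = 0) : ⟪A.n, u⟫ * ⟪B.n, u⟫ = 0 := by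
    obtain ⟨k, -, h⟩ := h
    obtain ⟨k', -, h'⟩ := h'
    have hsec (u : E3) (hu : ⟪S.n, u⟫ = 0) : 2 * μ * (⟪A.n, u⟫ * ⟪B.n, u⟫)
        = (k - κ * k') * (S.e (p + u) + S.e (p - u) - 2 * S.e p) := by
      have h1 := hμ (p + u)
      have h2 := hμ (p - u)
      have h3 := hμ p
      have hm : ⟪S.n, p - u⟫ = S.c := by rw [inner_sub_right, hu, hpS, sub_zero]
      rw [h _ (inner_add hpS hu), h' _ (inner_add hpS hu)] at h1
      rw [h _ hm, h' _ hm] at h2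
      rw [h _ hpS, h' _ hpS] at h3
      simp only [inner_add_right, inner_sub_right] at h1 h2 h3
      linear_combination 2 * h3 - h1 - h2
    obtain ⟨v, hv, hvS, hvA⟩ := exists_ne_zero_inner_eq_zero S.n A.n
    have h1 := hsec v hvS
    have h2 := S.convex v hv hvS p
    rw [hvA, zero_mul, mul_zero, eq_comm] at h1
    have h3 : k - κ * k' = 0 := (mul_eq_zero.mp h1).resolve_right (by linarith)
    have h4 := hsec u hu
    rw [h3, zero_mul] at h4
    exact (mul_eq_zero.mp h4).resolve_left (by simpa using hμ0)
  have hlin {S : EllSection K} {a b : E3} (hwS : ⟪S.n, w⟫ = 0) (haw : ⟪a, w⟫ ≠ 0)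
      (h : ∀ u, ⟪S.n, u⟫ = 0 → ⟪a, u⟫ * ⟪b, u⟫ = 0) (u : E3) (hu : ⟪S.n, u⟫ = 0) :
      ⟪b, u⟫ = 0 := by
    have hbw : ⟪b, w⟫ = 0 := (mul_eq_zero.mp (h w hwS)).resolve_left haw
    have h1 := h (u + w) (by rw [inner_add_right, hu, hwS, add_zero])
    have h2 := h u hu
    rw [inner_add_right, inner_add_right, hbw] at h1
    exact (mul_eq_zero.mp (by linarith : ⟪a, w⟫ * ⟪b, u⟫ = 0)).resolve_left haw
  rcases hw with hw | hw
  · have := eq_zero_of_forall_orthogonal hPP (hlin hwP hw (hform hP hPq' hpP))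
      (hlin hwP' hw (hform hP' hPq'' hpP'))
    exact hAB (by rw [this]; apply ext_E3 <;> simp)
  · have := eq_zero_of_forall_orthogonal hPP
      (hlin hwP hw fun u hu => by rw [mul_comm]; exact hform hP hPq' hpP u hu)
      (hlin hwP' hw fun u hu => by rw [mul_comm]; exact hform hP' hPq'' hpP' u hu)
    exact hAB (by rw [this]; apply ext_E3 <;> simp)

/-- A plane section of a convex body whose boundary is an ellipse. -/
theorem exists_ellSection (hK : IsCompact K) (hconv : Convex ℝ K) {n : E3} (hn : n ≠ 0) {c : ℝ}
    (h : IsEllipse (frontier K ∩ {x : E3 | ⟪n, x⟫ = c})) :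
    ∃ S : EllSection K, S.n = n ∧ S.c = c := by
  obtain ⟨f, hf⟩ := h
  have hfy (y : E3) : f y = f.linear y + f 0 := congrFun f.toAffineMap.decomp y
  have hcircle (a b : ℝ) (hab : a ^ 2 + b ^ 2 = 1) :
      f !₂[a, b, 0] ∈ frontier K ∩ {x : E3 | ⟪n, x⟫ = c} := by
    rw [hf]; exact ⟨_, ⟨by simpa using hab, by simp⟩, rfl⟩
  have hN (y : E3) : ⟪n, f y⟫ - c = y 2 * ⟪n, f.linear !₂[0, 0, 1]⟫ := by
    have hy : y = y 0 • !₂[1, 0, 0] + y 1 • !₂[0, 1, 0] + y 2 • !₂[0, 0, 1] := by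
      apply ext_E3 <;> simp
    have h1 : ⟪n, f !₂[1, 0, 0]⟫ = c := (hcircle 1 0 (by norm_num)).2
    have h2 : ⟪n, f !₂[-1, 0, 0]⟫ = c := (hcircle (-1) 0 (by norm_num)).2
    have h3 : ⟪n, f !₂[0, 1, 0]⟫ = c := (hcircle 0 1 (by norm_num)).2
    have h4 : (!₂[-1, 0, 0] : E3) = -!₂[1, 0, 0] := by apply ext_E3 <;> simp
    rw [hfy, inner_add_right] at h1 h2 h3
    rw [h4, map_neg, inner_neg_right] at h2
    rw [hfy, inner_add_right]
    conv_lhs => rw [hy]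
    simp only [map_add, map_smul, inner_add_right, inner_smul_right]
    have h5 : ⟪n, f 0⟫ = c := by linarith
    have h6 : ⟪n, f.linear !₂[1, 0, 0]⟫ = 0 := by linarith
    have h7 : ⟪n, f.linear !₂[0, 1, 0]⟫ = 0 := by linarith
    rw [h5, h6, h7]; ring
  have hγ : ⟪n, f.linear !₂[0, 0, 1]⟫ ≠ 0 := by
    intro h0
    have h1 (x : E3) : ⟪n, x⟫ - c = 0 := by
      have := hN (f.symm x)
      rwa [h0, mul_zero, f.apply_symm_apply] at this
    have h2 := h1 n
    have h3 := h1 0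
    rw [inner_zero_right] at h3
    exact hn ((inner_self_eq_zero (𝕜 := ℝ)).mp (by linarith))
  have hplane (x : E3) : ⟪n, x⟫ = c ↔ f.symm x 2 = 0 := by
    have := hN (f.symm x)
    rw [f.apply_symm_apply] at this
    constructor
    · intro h0
      rw [h0, sub_self, eq_comm] at this
      exact (mul_eq_zero.mp this).resolve_right hγ
    · intro h0
      rw [h0, zero_mul] at this
      linarith
  have hfr (x : E3) (hx : ⟪n, x⟫ = c) :
      x ∈ frontier K ↔ f.symm x 0 ^ 2 + f.symm x 1 ^ 2 - 1 = 0 := by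
    rw [sub_eq_zero]
    constructor
    · intro h1
      have h2 : x ∈ frontier K ∩ {x : E3 | ⟪n, x⟫ = c} := ⟨h1, hx⟩
      rw [hf] at h2
      obtain ⟨y, hy, rfl⟩ := h2
      rw [f.symm_apply_apply]; exact hy.1
    · intro h1
      have h2 : x ∈ f '' unitCircle3 :=
        ⟨f.symm x, ⟨h1, (hplane x).mp hx⟩, f.apply_symm_apply x⟩
      rw [← hf] at h2
      exact h2.1
  have hsub (x u : E3) : f.symm (x + u) = f.symm x + f.symm.linear u := by
    have := f.symm.map_vadd x u
    simpa [add_comm] using this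
  have hcoord (i : Fin 3) : IsQuad fun x => f.symm x i ^ 2 := by
    have h1 := (IsQuad.mul_affine (EuclideanSpace.single i 1) (EuclideanSpace.single i 1)
      0 0).comp_affine f.symm.toAffineMap
    simpa [EuclideanSpace.inner_single_left, sq] using h1
  refine ⟨⟨n, c, fun x => f.symm x 0 ^ 2 + f.symm x 1 ^ 2 - 1,
    ((hcoord 0).add (hcoord 1)).sub (IsQuad.const 1), fun u hu hnu x => ?_, fun x hx => ⟨?_, ?_⟩,
    hfr⟩, rfl, rfl⟩
  · have h1 : f.symm.linear u ≠ 0 := by simpa using hu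
    have h2 : f.symm.linear u 2 = 0 := by
      have h3 : ⟪n, f 0⟫ = c := (hplane _).mpr (by rw [f.symm_apply_apply]; rfl)
      have h4 := (hplane (f 0 + u)).mp (by rw [inner_add_right, h3, hnu, add_zero])
      rwa [hsub, f.symm_apply_apply, zero_add] at h4
    have h5 : 0 < f.symm.linear u 0 ^ 2 + f.symm.linear u 1 ^ 2 := by
      by_contra! h5
      refine h1 (ext_E3 ?_ ?_ h2) <;> simp only [PiLp.zero_apply] <;> nlinarith
    rw [sub_eq_add_neg x u, hsub, hsub, map_neg]
    simp only [PiLp.add_apply, PiLp.neg_apply]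
    linarith
  · intro hxi
    by_contra! hge
    have h0 : f.symm x 0 ^ 2 + f.symm x 1 ^ 2 - 1 ≠ 0 := fun h0 => ((hfr x hx).mpr h0).2 hxi
    have hpos := lt_of_le_of_ne hge h0.symm
    have hxf : x - f 0 ≠ 0 := by
      intro h1
      rw [sub_eq_zero] at h1
      rw [h1, f.symm_apply_apply] at hpos
      norm_num at hpos
    obtain ⟨t, ht, h1⟩ := exists_pos_mem_frontier hK hxi hxf
    have h2 : f.symm (x + t • (x - f 0)) = (1 + t) • f.symm x := by
      have h3 := hsub (f 0) (x - f 0)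
      rw [f.symm_apply_apply, zero_add, add_sub_cancel] at h3
      rw [hsub, map_smul, ← h3, add_smul, one_smul]
    have h4 : ⟪n, x + t • (x - f 0)⟫ = c := by
      rw [hplane, h2]
      simp [(hplane x).mp hx]
    rw [hfr _ h4, h2] at h1
    simp only [PiLp.smul_apply, smul_eq_mul] at h1
    have h5 : 1 < (1 + t) ^ 2 := by nlinarith
    have h6 : (1 + t) ^ 2 * (f.symm x 0 ^ 2 + f.symm x 1 ^ 2) = 1 := by linarith
    nlinarith
  · intro hlt
    have h2 := (hplane x).mp hx
    have hs : Real.sqrt (1 - f.symm x 1 ^ 2) ^ 2 = 1 - f.symm x 1 ^ 2 :=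
      Real.sq_sqrt (by nlinarith [sq_nonneg (f.symm x 0)])
    have hs0 := Real.sqrt_nonneg (1 - f.symm x 1 ^ 2)
    set s := Real.sqrt (1 - f.symm x 1 ^ 2)
    have hsx : |f.symm x 0| < s := abs_lt_of_sq_lt_sq (by linarith) hs0
    rw [abs_lt] at hsx
    have hp := hK.isClosed.frontier_subset (hcircle s (f.symm x 1) (by linarith)).1
    have hm := hK.isClosed.frontier_subset (hcircle (-s) (f.symm x 1) (by linarith [neg_sq s])).1
    have hseg : f.symm x ∈ segment ℝ (!₂[-s, f.symm x 1, 0] : E3) !₂[s, f.symm x 1, 0] := by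
      have hs' : 0 < s := by linarith
      refine ⟨(s - f.symm x 0) / (2 * s), (s + f.symm x 0) / (2 * s),
        div_nonneg (by linarith) (by linarith), div_nonneg (by linarith) (by linarith),
        by field_simp; ring, ?_⟩
      apply ext_E3
      · simp; field_simp; ring
      · simp; field_simp; ring
      · simp [h2]
    have hxK : x ∈ K := by
      have h3 : f (f.symm x) ∈ f '' segment ℝ (!₂[-s, f.symm x 1, 0] : E3) !₂[s, f.symm x 1, 0] :=
        ⟨_, hseg, rfl⟩
      have h4 := image_segment ℝ f.toAffineMap (!₂[-s, f.symm x 1, 0] : E3) !₂[s, f.symm x 1, 0]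
      rw [f.apply_symm_apply] at h3
      exact hconv.segment_subset hm hp (h4 ▸ h3)
    by_contra hxi
    exact hlt.ne ((hfr x hx).mp ⟨subset_closure hxK, hxi⟩)

/-- A continuous family of lines, one for each direction, with two elliptic sections of `K` through
each of them. -/
structure SectionSystem (K : Set E3) where
  /-- the point of a line closest to the origin -/
  δ : Metric.sphere (0 : E3) 1 → E3
  /-- the first section -/
  S₁ : Metric.sphere (0 : E3) 1 → EllSection K
  /-- the second section -/
  S₂ : Metric.sphere (0 : E3) 1 → EllSection K
  /-- a bound for the cosine of the angle between the sections -/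
  κ : ℝ
  continuous_δ : Continuous δ
  inner_δ : ∀ w : Metric.sphere (0 : E3) 1, ⟪(w : E3), δ w⟫ = 0
  δ_neg : ∀ w, δ (-w) = δ w
  norm_n₁ : ∀ w, ‖(S₁ w).n‖ = 1
  norm_n₂ : ∀ w, ‖(S₂ w).n‖ = 1
  inner_n₁ : ∀ w, ⟪(S₁ w).n, (w : E3)⟫ = 0
  inner_n₂ : ∀ w, ⟪(S₂ w).n, (w : E3)⟫ = 0
  inner_n₁_δ : ∀ w, ⟪(S₁ w).n, δ w⟫ = (S₁ w).c
  inner_n₂_δ : ∀ w, ⟪(S₂ w).n, δ w⟫ = (S₂ w).c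
  κ_lt : κ < 1
  inner_le : ∀ w, |⟪(S₁ w).n, (S₂ w).n⟫| ≤ κ
  mem_interior : ∀ v w : Metric.sphere (0 : E3) 1, v ≠ w → v ≠ -w → ∀ s t : ℝ,
    δ v + s • (v : E3) = δ w + t • (w : E3) → δ v + s • (v : E3) ∈ interior K

theorem inner_eq_zero_of_forall_norm_le {d w : E3} (hw : ‖w‖ = 1)
    (h : ∀ t : ℝ, ‖d‖ ≤ ‖d + t • w‖) : ⟪w, d⟫ = 0 := by
  have h1 := h (-⟪w, d⟫)
  have h2 : ‖d + (-⟪w, d⟫) • w‖ ^ 2 = ‖d‖ ^ 2 - ⟪w, d⟫ ^ 2 := by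
    rw [norm_add_sq_real, norm_smul, inner_smul_right, real_inner_comm, hw, mul_one,
      Real.norm_eq_abs, sq_abs]
    ring
  have h3 := pow_le_pow_left₀ (norm_nonneg _) h1 2
  rw [h2] at h3
  exact pow_eq_zero_iff two_ne_zero |>.mp (le_antisymm (by linarith) (sq_nonneg _))

theorem nonempty_sectionSystem (hK : IsCompact K) (hconv : Convex ℝ K)
    {α : ℝ} (hα : 0 < α) {𝓛 : Set (Set E3)} (h𝓛 : IsContinuousLineSystem 𝓛)
    (hcenter : lineSystemCenter 𝓛 ⊆ interior K)
    (h : ∀ L ∈ 𝓛, ∃ (H₁ H₂ : Set E3) (n₁ n₂ : E3),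
      IsPlaneWithNormal H₁ n₁ ∧ IsPlaneWithNormal H₂ n₂ ∧
      H₁ ∩ H₂ = L ∧
      α ≤ Real.arccos |⟪n₁, n₂⟫| ∧
      IsEllipse (frontier K ∩ H₁) ∧ IsEllipse (frontier K ∩ H₂)) :
    Nonempty (SectionSystem K) := by
  obtain ⟨⟨-, hex⟩, δ, hδ, hmin⟩ := h𝓛
  have hnorm (w : Metric.sphere (0 : E3) 1) : ‖(w : E3)‖ = 1 := by simp
  choose L hL huniq using fun w : Metric.sphere (0 : E3) 1 => hex w (hnorm w)
  have hmin' (w : Metric.sphere (0 : E3) 1) := hmin w (hnorm w) (L w) (hL w).1 (hL w).2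
  have hLeq (w : Metric.sphere (0 : E3) 1) : L w = lineThrough (δ w) w := by
    obtain ⟨p, hp⟩ := (hL w).2
    have h1 := (hmin' w).1
    rw [hp] at h1 ⊢
    obtain ⟨s, hs⟩ := h1
    ext x
    constructor
    · rintro ⟨t, rfl⟩
      exact ⟨t - s, by rw [hs, sub_smul]; abel⟩
    · rintro ⟨t, rfl⟩
      exact ⟨s + t, by rw [hs, add_smul]; abel⟩
  have hinner (w : Metric.sphere (0 : E3) 1) : ⟪(w : E3), δ w⟫ = 0 :=
    inner_eq_zero_of_forall_norm_le (hnorm w) fun t =>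
      (hmin' w).2 _ (by rw [hLeq]; exact ⟨t, rfl⟩)
  have hneg (w : Metric.sphere (0 : E3) 1) : δ (-w : Metric.sphere (0 : E3) 1) = δ w := by
    have h1 : L (-w) = L w := huniq w _ ⟨(hL (-w)).1, by
      obtain ⟨p, hp⟩ := (hL (-w)).2
      refine ⟨p, ?_⟩
      rw [hp]
      ext x
      constructor <;> rintro ⟨t, rfl⟩ <;> exact ⟨-t, by simp⟩⟩
    have h2 := (hmin' (-w)).1
    rw [h1, hLeq] at h2
    obtain ⟨t, ht⟩ := h2
    have h3 := hinner (-w)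
    rw [ht, inner_add_right, inner_smul_right] at h3
    simp only [coe_neg_sphere, inner_neg_left, hinner w, real_inner_self_eq_norm_sq,
      hnorm w] at h3 ht
    rw [coe_neg_sphere, ht, show t = 0 by linarith, zero_smul, add_zero]
  have hsec (w : Metric.sphere (0 : E3) 1) : ∃ S₁ S₂ : EllSection K, ‖S₁.n‖ = 1 ∧ ‖S₂.n‖ = 1 ∧
      (∀ x ∈ L w, ⟪S₁.n, x⟫ = S₁.c) ∧ (∀ x ∈ L w, ⟪S₂.n, x⟫ = S₂.c) ∧
      α ≤ Real.arccos |⟪S₁.n, S₂.n⟫| := by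
    obtain ⟨H₁, H₂, n₁, n₂, ⟨hn₁, c₁, rfl⟩, ⟨hn₂, c₂, rfl⟩, hH, ha, hE₁, hE₂⟩ := h _ (hL w).1
    obtain ⟨S₁, rfl, rfl⟩ := exists_ellSection hK hconv (norm_ne_zero_iff.mp (by simp [hn₁])) hE₁
    obtain ⟨S₂, rfl, rfl⟩ := exists_ellSection hK hconv (norm_ne_zero_iff.mp (by simp [hn₂])) hE₂
    refine ⟨S₁, S₂, hn₁, hn₂, fun x hx => ?_, fun x hx => ?_, ha⟩
    · rw [← hH] at hx; exact hx.1
    · rw [← hH] at hx; exact hx.2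
  choose S₁ S₂ hn₁ hn₂ hp₁ hp₂ ha using hsec
  have hdir {w : Metric.sphere (0 : E3) 1} {S : EllSection K}
      (hS : ∀ x ∈ L w, ⟪S.n, x⟫ = S.c) : ⟪S.n, (w : E3)⟫ = 0 := by
    have h1 := hS (δ w) (hmin' w).1
    have h2 := hS (δ w + (1 : ℝ) • (w : E3)) (by rw [hLeq]; exact ⟨1, rfl⟩)
    rw [one_smul, inner_add_right, h1] at h2
    linarith
  have hle1 (w : Metric.sphere (0 : E3) 1) : |⟪(S₁ w).n, (S₂ w).n⟫| ≤ 1 := by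
    have := abs_real_inner_le_norm (S₁ w).n (S₂ w).n
    rwa [hn₁, hn₂, one_mul] at this
  have hαπ (w : Metric.sphere (0 : E3) 1) : α ≤ Real.pi := (ha w).trans (Real.arccos_le_pi _)
  refine ⟨⟨fun w => δ w, S₁, S₂, Real.cos α, hδ.domRestrict, hinner, hneg, hn₁, hn₂,
    fun w => hdir (hp₁ w), fun w => hdir (hp₂ w), fun w => hp₁ w _ (hmin' w).1,
    fun w => hp₂ w _ (hmin' w).1, ?_, fun w => ?_, fun v w hvw hvw' s t hst => ?_⟩⟩
  · have hπ := hαπ ⟨EuclideanSpace.single 0 1, by simp⟩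
    simpa using Real.cos_lt_cos_of_nonneg_of_le_pi le_rfl hπ hα
  · have := Real.cos_le_cos_of_nonneg_of_le_pi hα.le (Real.arccos_le_pi _) (ha w)
    rwa [Real.cos_arccos (by linarith [abs_nonneg ⟪(S₁ w).n, (S₂ w).n⟫]) (hle1 w)] at this
  · refine hcenter ⟨L v, (hL v).1, L w, (hL w).1, fun hLL => ?_, by rw [hLeq]; exact ⟨s, rfl⟩,
      by rw [hLeq]; exact ⟨t, hst⟩⟩
    have h1 : δ v ∈ L w := hLL ▸ (hmin' v).1
    have h2 : δ v + (1 : ℝ) • (v : E3) ∈ L w := by rw [← hLL, hLeq]; exact ⟨1, rfl⟩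
    rw [hLeq] at h1 h2
    obtain ⟨a, ha⟩ := h1
    obtain ⟨b, hb⟩ := h2
    rw [ha, one_smul, add_assoc, add_right_inj] at hb
    have h3 : (v : E3) = (b - a) • (w : E3) := by rw [sub_smul, ← hb]; abel
    have h4 := congrArg norm h3
    rw [norm_smul, hnorm, hnorm, mul_one, Real.norm_eq_abs, eq_comm, abs_eq zero_le_one] at h4
    rcases h4 with h4 | h4
    · exact hvw (Subtype.ext (by rw [h3, h4, one_smul]))
    · exact hvw' (Subtype.ext (by rw [h3, h4]; simp))

theorem cross3_add_right (a b c : E3) : cross3 a (b + c) = cross3 a b + cross3 a c := by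
  apply ext_E3 <;> simp <;> ring

theorem cross3_smul_right (a b : E3) (t : ℝ) : cross3 a (t • b) = t • cross3 a b := by
  apply ext_E3 <;> simp <;> ring

theorem exists_norm_eq_one_inner_eq_zero (v : E3) : ∃ e : E3, ‖e‖ = 1 ∧ ⟪v, e⟫ = 0 := by
  obtain ⟨u, hu, hv, -⟩ := exists_ne_zero_inner_eq_zero v v
  refine ⟨‖u‖⁻¹ • u, norm_smul_inv_norm hu, by rw [inner_smul_right, hv, mul_zero]⟩

/-- A vector orthogonal to `v × w` is a combination of the orthonormal vectors `v` and `w`. -/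
theorem eq_add_of_inner_cross3_eq_zero {v w d : E3} (hv : ‖v‖ = 1) (hw : ‖w‖ = 1)
    (hvw : ⟪v, w⟫ = 0) (hd : ⟪cross3 v w, d⟫ = 0) : d = ⟪v, d⟫ • v + ⟪w, d⟫ • w := by
  have h1 := cross3_expansion v w (cross3 v w) d
  have hwv : ⟪w, v⟫ = 0 := by rw [real_inner_comm, hvw]
  have h2 : cross3 w (cross3 v w) = v := by
    rw [cross3_cross3, real_inner_self_eq_norm_sq, hw, hwv]; simp
  have h3 : cross3 (cross3 v w) v = w := by
    have h4 : cross3 v (cross3 v w) = -w := by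
      rw [cross3_cross3, real_inner_self_eq_norm_sq, hv, hvw]; simp
    rw [← neg_eq_iff_eq_neg] at h4
    refine Eq.trans ?_ h4
    apply ext_E3 <;> simp <;> ring
  rwa [h2, h3, hd, real_inner_self_eq_norm_sq, hv, zero_smul, add_zero, one_pow, one_smul] at h1

namespace SectionSystem

/-- Every line of the system meets another one. -/
theorem exists_meeting (T : SectionSystem K) (v : Metric.sphere (0 : E3) 1) :
    ∃ w : Metric.sphere (0 : E3) 1, w ≠ v ∧ w ≠ -v ∧ ∃ s t : ℝ,
      T.δ v + s • (v : E3) = T.δ w + t • (w : E3) := by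
  have hv : ‖(v : E3)‖ = 1 := by simp
  obtain ⟨e, he, hve⟩ := exists_norm_eq_one_inner_eq_zero (v : E3)
  have hev : ⟪e, (v : E3)⟫ = 0 := by rw [real_inner_comm, hve]
  set e' := cross3 (v : E3) e with he'
  have hve' : ⟪(v : E3), e'⟫ = 0 := inner_left_cross3 _ _
  have hee' : ⟪e, e'⟫ = 0 := inner_right_cross3 _ _
  have he1' : ‖e'‖ = 1 := by
    have h1 := norm_sq_cross3 (v : E3) e
    rw [real_inner_self_eq_norm_sq, real_inner_self_eq_norm_sq, real_inner_self_eq_norm_sq, hv, he,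
      hve] at h1
    exact (pow_eq_one_iff_of_nonneg (norm_nonneg _) two_ne_zero).mp (by rw [he', h1]; norm_num)
  have hnorm (θ : ℝ) : ‖Real.cos θ • e + Real.sin θ • e'‖ = 1 := by
    refine (pow_eq_one_iff_of_nonneg (norm_nonneg _) two_ne_zero).mp ?_
    rw [norm_add_sq_real, norm_smul, norm_smul, he, he1', inner_smul_left, inner_smul_right, hee']
    simp
  have hcross (θ : ℝ) : cross3 (v : E3) (Real.cos θ • e + Real.sin θ • e')
      = Real.cos θ • e' - Real.sin θ • e := by
    rw [cross3_add_right, cross3_smul_right, cross3_smul_right, ← he', he', cross3_cross3,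
      hve, real_inner_self_eq_norm_sq, hv]
    simp [sub_eq_add_neg]
  let w : ℝ → Metric.sphere (0 : E3) 1 := fun θ =>
    ⟨Real.cos θ • e + Real.sin θ • e', by simpa using hnorm θ⟩
  have hw : Continuous w := by
    refine Continuous.subtype_mk ?_ _
    fun_prop
  have hvw (θ : ℝ) : ⟪(v : E3), w θ⟫ = 0 := by
    simp [w, inner_add_right, inner_smul_right, hve, hve']
  let D : ℝ → ℝ := fun θ => ⟪Real.cos θ • e' - Real.sin θ • e, T.δ (w θ) - T.δ v⟫
  have hD : Continuous D := by
    have := T.continuous_δ.comp hw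
    refine Continuous.inner (by fun_prop) (this.sub continuous_const)
  have hDπ : D Real.pi = -D 0 := by
    have h1 : w Real.pi = -w 0 := Subtype.ext (by simp [w])
    simp only [D, h1, T.δ_neg]
    simp
  obtain ⟨θ, hθ⟩ : ∃ θ, D θ = 0 := by
    rcases le_total (D 0) 0 with h0 | h0
    · exact mem_range_of_exists_le_of_exists_ge hD ⟨0, h0⟩ ⟨Real.pi, by linarith⟩
    · exact mem_range_of_exists_le_of_exists_ge hD ⟨Real.pi, by linarith⟩ ⟨0, h0⟩
  have hne (h : ⟪(v : E3), (v : E3)⟫ = 0) : False := by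
    rw [real_inner_self_eq_norm_sq, hv] at h; norm_num at h
  refine ⟨w θ, fun h => hne ?_, fun h => hne ?_, ⟪(v : E3), T.δ (w θ) - T.δ v⟫,
    -⟪(w θ : E3), T.δ (w θ) - T.δ v⟫, ?_⟩
  · have := hvw θ; rwa [h] at this
  · have := hvw θ
    rw [h, coe_neg_sphere, inner_neg_right] at this
    linarith
  · have h1 := eq_add_of_inner_cross3_eq_zero hv (hnorm θ) (hvw θ)
      (d := T.δ (w θ) - T.δ v) (by rw [hcross]; exact hθ)
    change _ = _ + ⟪(w θ : E3), _⟫ • (w θ : E3) at h1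
    rw [neg_smul, ← sub_eq_add_neg, eq_sub_iff_add_eq, add_assoc, ← h1]
    abel

end SectionSystem

theorem eq_or_eq_neg_of_eq_smul {v w : Metric.sphere (0 : E3) 1} {s : ℝ}
    (h : (v : E3) = s • (w : E3)) : v = w ∨ v = -w := by
  have h1 := congrArg norm h
  simp only [norm_smul, norm_eq_of_mem_sphere, mul_one, Real.norm_eq_abs] at h1
  rw [eq_comm, abs_eq zero_le_one] at h1
  rcases h1 with h1 | h1
  · exact Or.inl (Subtype.ext (by rw [h, h1, one_smul]))
  · exact Or.inr (Subtype.ext (by rw [h, h1]; simp))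

theorem eq_of_inner_eq {a b c x y : E3} (h : ⟪a, cross3 b c⟫ ≠ 0) (ha : ⟪a, x⟫ = ⟪a, y⟫)
    (hb : ⟪b, x⟫ = ⟪b, y⟫) (hc : ⟪c, x⟫ = ⟪c, y⟫) : x = y := by
  have h1 := cross3_expansion a b c (x - y)
  rw [inner_sub_right, inner_sub_right, inner_sub_right, ha, hb, hc] at h1
  simp only [sub_self, zero_smul, add_zero] at h1
  exact sub_eq_zero.mp ((smul_eq_zero.mp h1).resolve_left h)

namespace SectionSystem

variable (T : SectionSystem K)

theorem cross3_ne_zero (w : Metric.sphere (0 : E3) 1) : cross3 (T.S₁ w).n (T.S₂ w).n ≠ 0 := by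
  intro h
  have h1 := norm_sq_cross3 (T.S₁ w).n (T.S₂ w).n
  rw [h, inner_zero_left, real_inner_self_eq_norm_sq, real_inner_self_eq_norm_sq, T.norm_n₁,
    T.norm_n₂, ← sq_abs ⟪_, _⟫] at h1
  have h2 := T.inner_le w
  have h3 := T.κ_lt
  nlinarith [abs_nonneg ⟪(T.S₁ w).n, (T.S₂ w).n⟫]

theorem exists_eq_smul {w : Metric.sphere (0 : E3) 1} {x : E3} (h₁ : ⟪(T.S₁ w).n, x⟫ = 0)
    (h₂ : ⟪(T.S₂ w).n, x⟫ = 0) : ∃ s : ℝ, x = s • (w : E3) := by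
  obtain ⟨k, hk⟩ := exists_eq_smul_cross3 (T.cross3_ne_zero w) (T.inner_n₁ w) (T.inner_n₂ w)
  obtain ⟨k', hk'⟩ := exists_eq_smul_cross3 (T.cross3_ne_zero w) h₁ h₂
  have hk0 : k ≠ 0 := by
    rintro rfl
    rw [zero_smul] at hk
    exact ne_zero_of_mem_unit_sphere w hk
  exact ⟨k' / k, by rw [hk, hk', smul_smul, div_mul_cancel₀ _ hk0]⟩

theorem inner_ne_zero_or {v w : Metric.sphere (0 : E3) 1} (h : w ≠ v) (h' : w ≠ -v) :
    ⟪(T.S₁ v).n, (w : E3)⟫ ≠ 0 ∨ ⟪(T.S₂ v).n, (w : E3)⟫ ≠ 0 := by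
  by_contra! h0
  obtain ⟨s, hs⟩ := T.exists_eq_smul h0.1 h0.2
  exact (eq_or_eq_neg_of_eq_smul hs).elim h h'

/-- Every line of the system meets transversally a section at an interior point. -/
theorem exists_transversal (v : Metric.sphere (0 : E3) 1) : ∃ (F : EllSection K) (s : ℝ),
    ⟪F.n, (v : E3)⟫ ≠ 0 ∧ ⟪F.n, T.δ v + s • (v : E3)⟫ = F.c ∧
      T.δ v + s • (v : E3) ∈ interior K := by
  obtain ⟨w, h, h', s, t, hst⟩ := T.exists_meeting v
  have hv : v ≠ w := h.symm
  have hv' : v ≠ -w := fun h0 => h' (by rw [h0, neg_neg])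
  have hint := T.mem_interior v w hv hv' s t hst
  rcases T.inner_ne_zero_or hv hv' with h0 | h0
  · exact ⟨T.S₁ w, s, h0, by rw [hst]; exact inner_add_smul (T.inner_n₁_δ w) (T.inner_n₁ w) t, hint⟩
  · exact ⟨T.S₂ w, s, h0, by rw [hst]; exact inner_add_smul (T.inner_n₂_δ w) (T.inner_n₂ w) t, hint⟩

theorem det_ne_zero {v : Metric.sphere (0 : E3) 1} {F : E3} (hF : ⟪F, (v : E3)⟫ ≠ 0) :
    ⟪(T.S₁ v).n, cross3 (T.S₂ v).n F⟫ ≠ 0 := by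
  obtain ⟨k, hk⟩ := exists_eq_smul_cross3 (T.cross3_ne_zero v) (T.inner_n₁ v) (T.inner_n₂ v)
  rw [inner_cross3_rotate, inner_cross3_rotate]
  intro h0
  rw [hk, inner_smul_right, h0, mul_zero] at hF
  exact hF rfl

/-- Sections through a line close to `v`, provided the planes meet inside `K`. -/
theorem goodFor_of_ne (hK : IsCompact K) (hconv : Convex ℝ K) {q : E3 → ℝ} (hq : IsQuad q)
    {v w : Metric.sphere (0 : E3) 1} {F P P' : EllSection K} (hwv : w ≠ v) (hwv' : w ≠ -v)
    (h₁ : GoodFor q (T.S₁ v)) (h₂ : GoodFor q (T.S₂ v)) (hF : GoodFor q F)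
    (hFv : ⟪F.n, (v : E3)⟫ ≠ 0) {s : ℝ} (hFs : ⟪F.n, T.δ v + s • (v : E3)⟫ = F.c)
    (hs : T.δ v + s • (v : E3) ∈ interior K) {t : ℝ} (hFw : ⟪F.n, (w : E3)⟫ ≠ 0)
    (hFt : ⟪F.n, T.δ w + t • (w : E3)⟫ = F.c) (ht : T.δ w + t • (w : E3) ∈ interior K)
    (hP : ⟪P.n, T.δ w⟫ = P.c) (hPw : ⟪P.n, (w : E3)⟫ = 0)
    (hP' : ⟪P'.n, T.δ w⟫ = P'.c) (hPw' : ⟪P'.n, (w : E3)⟫ = 0)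
    (ho : ∃ o ∈ interior K, ⟪P.n, o⟫ = P.c ∧ ⟪(T.S₂ v).n, o⟫ = (T.S₂ v).c ∧ ⟪F.n, o⟫ = F.c)
    (hdet : ⟪P.n, cross3 (T.S₂ v).n F.n⟫ ≠ 0)
    (ho' : ∃ o ∈ interior K, ⟪P'.n, o⟫ = P'.c ∧ ⟪(T.S₁ v).n, o⟫ = (T.S₁ v).c ∧ ⟪F.n, o⟫ = F.c)
    (hdet' : ⟪P'.n, cross3 (T.S₁ v).n F.n⟫ ≠ 0) : GoodFor q P ∧ GoodFor q P' := by
  obtain ⟨o, ho, hoP, hoB, hoF⟩ := ho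
  obtain ⟨o', ho', hoP', hoA', hoF'⟩ := ho'
  by_cases hmeet : ∃ a b : ℝ, T.δ v + a • (v : E3) = T.δ w + b • (w : E3)
  · obtain ⟨a, b, hab⟩ := hmeet
    have hint := T.mem_interior v w hwv.symm (fun h => hwv' (by rw [h, neg_neg])) a b hab
    have hp₁ := inner_add_smul (T.inner_n₁_δ v) (T.inner_n₁ v) a
    have hp₂ := inner_add_smul (T.inner_n₂_δ v) (T.inner_n₂ v) a
    have hpP := inner_add_smul hP hPw b
    have hpP' := inner_add_smul hP' hPw' b
    rw [← hab] at hpP hpP'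
    have hd := T.det_ne_zero hFv
    have hx (x : E3) (hx₁ : ⟪(T.S₁ v).n, x⟫ = (T.S₁ v).c) (hx₂ : ⟪(T.S₂ v).n, x⟫ = (T.S₂ v).c)
        (hxF : ⟪F.n, x⟫ = F.c) : x ∈ interior K := by
      rw [eq_of_inner_eq hd (x := x) (y := T.δ v + s • (v : E3))]
      · exact hs
      · rw [hx₁]; exact (inner_add_smul (T.inner_n₁_δ v) (T.inner_n₁ v) s).symm
      · rw [hx₂]; exact (inner_add_smul (T.inner_n₂_δ v) (T.inner_n₂ v) s).symm
      · rw [hxF, hFs]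
    refine ⟨h₁.of_concurrent hK hconv hq h₂ hF hd hx hoP hoB hoF ho hdet hpP hp₁ hp₂ hint,
      h₂.of_concurrent hK hconv hq h₁ hF ?_ (fun x a b c => hx x b a c) hoP' hoA' hoF' ho' hdet'
        hpP' hp₂ hp₁ hint⟩
    rw [inner_cross3_rotate, inner_cross3_swap]
    exact neg_ne_zero.mpr hd
  · refine h₁.of_skew hK hq h₂ hF hoP hoB hoF ho hdet hoP' hoA' hoF' ho' hdet'
      (inner_add_smul hP hPw t) (inner_add_smul hP' hPw' t) hFt ht hPw hPw' hFw
      (T.inner_ne_zero_or hwv hwv') fun r hr₁ hr₂ => hmeet ?_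
    obtain ⟨a, ha⟩ := T.exists_eq_smul (w := v)
      (x := T.δ w + t • (w : E3) + r • (w : E3) - T.δ v)
      (by rw [inner_sub_right, hr₁, T.inner_n₁_δ, sub_self])
      (by rw [inner_sub_right, hr₂, T.inner_n₂_δ, sub_self])
    refine ⟨a, t + r, ?_⟩
    rw [← ha, add_smul]; abel

end SectionSystem

theorem exists_mem_three_planes {H F P : EllSection K} {o y : E3} {ρ ε : ℝ}
    (hρ : Metric.ball o ρ ⊆ interior K) (hH : ⟪H.n, o⟫ = H.c) (hF : ⟪F.n, o⟫ = F.c)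
    (hP : ⟪P.n, y⟫ = P.c) (hPn : ‖P.n‖ = 1) (hε : 0 < ε) (hd : ε ≤ |⟪P.n, cross3 H.n F.n⟫|)
    (hy : ‖y - o‖ * ‖cross3 H.n F.n‖ < ρ * ε) :
    ∃ x ∈ interior K, ⟪P.n, x⟫ = P.c ∧ ⟪H.n, x⟫ = H.c ∧ ⟪F.n, x⟫ = F.c := by
  have hd0 : 0 < |⟪P.n, cross3 H.n F.n⟫| := hε.trans_le hd
  refine ⟨o + (⟪P.n, y - o⟫ / ⟪P.n, cross3 H.n F.n⟫) • cross3 H.n F.n, hρ ?_, ?_,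
    inner_add_smul hH (inner_left_cross3 _ _) _, inner_add_smul hF (inner_right_cross3 _ _) _⟩
  · rw [mem_ball_iff_norm, add_sub_cancel_left, norm_smul, norm_div, Real.norm_eq_abs,
      Real.norm_eq_abs, div_mul_eq_mul_div, div_lt_iff₀ hd0]
    have h1 := abs_real_inner_le_norm P.n (y - o)
    rw [hPn, one_mul] at h1
    have hρ0 : 0 < ρ := pos_of_mul_pos_left ((by positivity : (0 : ℝ) ≤ _).trans_lt hy) hε.le
    calc |⟪P.n, y - o⟫| * ‖cross3 H.n F.n‖ ≤ ‖y - o‖ * ‖cross3 H.n F.n‖ := by gcongr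
      _ < ρ * ε := hy
      _ ≤ ρ * |⟪P.n, cross3 H.n F.n⟫| := by gcongr
  · rw [inner_add_right, inner_smul_right, div_mul_cancel₀ _ (abs_pos.mp hd0), inner_sub_right, hP]
    ring

theorem eq_zero_of_inner_cross3 {v n a b m : E3} (hvm : ⟪v, m⟫ ≠ 0) (hab : cross3 a b ≠ 0)
    (ha : ⟪v, a⟫ = 0) (hb : ⟪v, b⟫ = 0) (hv : ⟪v, n⟫ = 0) (h1 : ⟪cross3 a m, n⟫ = 0)
    (h2 : ⟪cross3 b m, n⟫ = 0) : n = 0 := by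
  have h3 (c : E3) (hc : ⟪v, c⟫ = 0) (hn : ⟪cross3 c m, n⟫ = 0) : cross3 c n = 0 := by
    rcases eq_or_ne c 0 with rfl | hc0
    · apply ext_E3 <;> simp
    have hdet : ⟪v, cross3 c (cross3 c m)⟫ ≠ 0 := by
      rw [cross3_cross3, inner_sub_right, inner_smul_right, inner_smul_right, hc, mul_zero,
        zero_sub]
      exact neg_ne_zero.mpr (mul_ne_zero (by simpa using hc0) hvm)
    have hne : cross3 v (cross3 c m) ≠ 0 := by
      rw [cross3_cross3, hc, zero_smul, sub_zero]
      exact smul_ne_zero hvm hc0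
    obtain ⟨k, hk⟩ := exists_eq_smul_cross3 hne hv hn
    rw [hk, cross3_cross3, hc, zero_smul, sub_zero, smul_smul]
    apply ext_E3 <;> simp <;> ring
  have h4 := h3 a ha h1
  have h5 := h3 b hb h2
  by_contra hn
  have hp (c : E3) (hc : cross3 c n = 0) : c = (⟪n, c⟫ / ⟪n, n⟫) • n := by
    have h6 := cross3_cross3 n c n
    rw [hc] at h6
    have h7 : cross3 n 0 = 0 := by apply ext_E3 <;> simp
    rw [h7, eq_comm, sub_eq_zero] at h6
    have h8 : ⟪n, n⟫ ≠ 0 := by simpa using hn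
    rw [div_eq_inv_mul, mul_smul, eq_inv_smul_iff₀ h8, h6]
  apply hab
  rw [hp a h4, hp b h5]
  apply ext_E3 <;> simp <;> ring

/-- A pair of transversal planes through a line close to `v` can be matched with a pair of planes
through `v`. -/
theorem exists_matching_bound {κ : ℝ} (hκ : κ < 1) {v a b m : E3} (hvm : ⟪v, m⟫ ≠ 0)
    (hab : cross3 a b ≠ 0) (ha : ⟪v, a⟫ = 0) (hb : ⟪v, b⟫ = 0) :
    ∃ μ : ℝ, 0 < μ ∧ ∀ n n' : E3, ‖n‖ = 1 → ‖n'‖ = 1 → |⟪n, n'⟫| ≤ κ →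
      μ ≤ |⟪n, v⟫| + |⟪n', v⟫| + |⟪n, cross3 a m⟫| * |⟪n', cross3 b m⟫|
        + |⟪n, cross3 b m⟫| * |⟪n', cross3 a m⟫| := by
  have hcpt : IsCompact ({p : E3 × E3 | |⟪p.1, p.2⟫| ≤ κ} ∩
      Metric.sphere (0 : E3) 1 ×ˢ Metric.sphere (0 : E3) 1) :=
    ((isCompact_sphere _ _).prod (isCompact_sphere _ _)).inter_left
      (isClosed_le (by fun_prop) continuous_const)
  suffices hpos : ∀ p ∈ {p : E3 × E3 | |⟪p.1, p.2⟫| ≤ κ} ∩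
      Metric.sphere (0 : E3) 1 ×ˢ Metric.sphere (0 : E3) 1,
      0 < |⟪p.1, v⟫| + |⟪p.2, v⟫| + |⟪p.1, cross3 a m⟫| * |⟪p.2, cross3 b m⟫|
        + |⟪p.1, cross3 b m⟫| * |⟪p.2, cross3 a m⟫| by
    obtain ⟨μ, hμ, h⟩ := hcpt.exists_forall_le' (by fun_prop) hpos
    exact ⟨μ, hμ, fun n n' hn hn' hi => h (n, n') ⟨hi, by simpa using hn, by simpa using hn'⟩⟩
  rintro ⟨n, n'⟩ ⟨hi, hn, hn'⟩
  simp only [Set.mem_ofPred_eq, mem_sphere_zero_iff_norm] at hi hn hn'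
  by_contra! hle
  have h1 := abs_nonneg ⟪n, v⟫
  have h2 := abs_nonneg ⟪n', v⟫
  have h3 := mul_nonneg (abs_nonneg ⟪n, cross3 a m⟫) (abs_nonneg ⟪n', cross3 b m⟫)
  have h4 := mul_nonneg (abs_nonneg ⟪n, cross3 b m⟫) (abs_nonneg ⟪n', cross3 a m⟫)
  have hv : ⟪v, n⟫ = 0 := by rw [real_inner_comm]; exact abs_eq_zero.mp (by linarith)
  have hv' : ⟪v, n'⟫ = 0 := by rw [real_inner_comm]; exact abs_eq_zero.mp (by linarith)
  have hn0 : n ≠ 0 := norm_ne_zero_iff.mp (by rw [hn]; exact one_ne_zero)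
  have hn0' : n' ≠ 0 := norm_ne_zero_iff.mp (by rw [hn']; exact one_ne_zero)
  have e1 : ⟪cross3 a m, n⟫ = 0 ∨ ⟪cross3 b m, n'⟫ = 0 := by
    simpa [real_inner_comm] using mul_eq_zero.mp (by linarith :
      |⟪n, cross3 a m⟫| * |⟪n', cross3 b m⟫| = 0)
  have e2 : ⟪cross3 b m, n⟫ = 0 ∨ ⟪cross3 a m, n'⟫ = 0 := by
    simpa [real_inner_comm] using mul_eq_zero.mp (by linarith :
      |⟪n, cross3 b m⟫| * |⟪n', cross3 a m⟫| = 0)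
  have hpar (c : E3) (hc : ⟪v, c⟫ = 0) (hc0 : c ≠ 0) (e1 : ⟪cross3 c m, n⟫ = 0)
      (e2 : ⟪cross3 c m, n'⟫ = 0) : False := by
    have hne : cross3 v (cross3 c m) ≠ 0 := by
      rw [cross3_cross3, hc, zero_smul, sub_zero]
      exact smul_ne_zero hvm hc0
    obtain ⟨k, hk⟩ := exists_eq_smul_cross3 hne hv e1
    obtain ⟨k', hk'⟩ := exists_eq_smul_cross3 hne hv' e2
    have hs := norm_sq_cross3 n n'
    have hz : cross3 n n' = 0 := by
      rw [hk, hk']; apply ext_E3 <;> simp <;> ring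
    rw [hz, inner_zero_left, real_inner_self_eq_norm_sq, real_inner_self_eq_norm_sq, hn, hn',
      ← sq_abs ⟪n, n'⟫] at hs
    nlinarith [abs_nonneg ⟪n, n'⟫]
  have ha0 : a ≠ 0 := by rintro rfl; apply hab; apply ext_E3 <;> simp
  have hb0 : b ≠ 0 := by rintro rfl; apply hab; apply ext_E3 <;> simp
  rcases e1 with e1 | e1 <;> rcases e2 with e2 | e2
  · exact hn0 (eq_zero_of_inner_cross3 hvm hab ha hb hv e1 e2)
  · exact hpar a ha ha0 e1 e2
  · exact hpar b hb hb0 e2 e1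
  · exact hn0' (eq_zero_of_inner_cross3 hvm hab ha hb hv' e2 e1)

theorem le_of_le_mul {x y μ R : ℝ} (hx : 0 ≤ x) (hR : 0 < R) (hy : y ≤ R) (h : μ ≤ x * y) :
    μ / R ≤ x := by
  rw [div_le_iff₀ hR]
  exact h.trans (by gcongr)

namespace SectionSystem

open Filter Topology

/-- Locally, all sections of the system fit one quadratic function. -/
theorem exists_eventually_goodFor (T : SectionSystem K) (hK : IsCompact K) (hconv : Convex ℝ K)
    (v : Metric.sphere (0 : E3) 1) :
    ∃ q, IsQuad q ∧ ∀ᶠ w in 𝓝 v, GoodFor q (T.S₁ w) ∧ GoodFor q (T.S₂ w) := by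
  obtain ⟨F, s, hFv, hFs, hs⟩ := T.exists_transversal v
  have h₁s := inner_add_smul (T.inner_n₁_δ v) (T.inner_n₁ v) s
  have h₂s := inner_add_smul (T.inner_n₂_δ v) (T.inner_n₂ v) s
  obtain ⟨q, hq, h₁, h₂, hF⟩ := exists_goodFor_three hK h₁s h₂s hFs hs (T.det_ne_zero hFv)
  refine ⟨q, hq, ?_⟩
  set o := T.δ v + s • (v : E3) with ho
  obtain ⟨ρ, hρ, hball⟩ := Metric.isOpen_iff.mp isOpen_interior o hs
  obtain ⟨μ, hμ, hmatch⟩ := exists_matching_bound T.κ_lt (v := v)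
    (by rwa [real_inner_comm] : ⟪(v : E3), F.n⟫ ≠ 0)
    (T.cross3_ne_zero v) (by rw [real_inner_comm, T.inner_n₁]) (by rw [real_inner_comm, T.inner_n₂])
  set d₁ := cross3 (T.S₁ v).n F.n with hd₁
  set d₂ := cross3 (T.S₂ v).n F.n with hd₂
  set R := 1 + ‖d₁‖ + ‖d₂‖ with hRdef
  have hR₁ : ‖d₁‖ ≤ R := by linarith [norm_nonneg d₂]
  have hR₂ : ‖d₂‖ ≤ R := by linarith [norm_nonneg d₁]
  have hR : 0 < R := by positivity
  set ε := μ / 4 / R with hε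
  have hε0 : 0 < ε := by positivity
  let t : Metric.sphere (0 : E3) 1 → ℝ := fun w => (F.c - ⟪F.n, T.δ w⟫) / ⟪F.n, (w : E3)⟫
  have hδ := T.continuous_δ
  have htc : ContinuousAt (fun w : Metric.sphere (0 : E3) 1 => T.δ w + t w • (w : E3)) v := by
    have h1 : ContinuousAt t v := by
      refine ContinuousAt.div ?_ ?_ hFv
      · fun_prop
      · fun_prop
    exact hδ.continuousAt.add (h1.smul continuous_subtype_val.continuousAt)
  have htv : T.δ v + t v • (v : E3) = o := by
    rw [ho, show t v = s from ?_]
    rw [inner_add_right, inner_smul_right] at hFs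
    simp only [t]
    rw [div_eq_iff hFv]; linarith
  have hev₁ : ∀ᶠ w : Metric.sphere (0 : E3) 1 in 𝓝 v, ‖(w : E3) - v‖ < μ / 4 := by
    have : ContinuousAt (fun w : Metric.sphere (0 : E3) 1 => ‖(w : E3) - v‖) v := by fun_prop
    exact this.eventually_lt continuousAt_const (by simpa using div_pos hμ four_pos)
  have hev₂ : ∀ᶠ w in 𝓝 v, ‖T.δ w + t w • (w : E3) - o‖ < ρ := by
    refine ContinuousAt.eventually_lt (htc.sub continuousAt_const).norm continuousAt_const ?_
    simpa [htv] using hρ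
  have hev₃ : ∀ᶠ w in 𝓝 v, ‖T.δ w + t w • (w : E3) - o‖ * R < ρ * ε := by
    refine ContinuousAt.eventually_lt
      ((htc.sub continuousAt_const).norm.mul continuousAt_const) continuousAt_const ?_
    simpa [htv] using mul_pos hρ hε0
  have hev₄ : ∀ᶠ w : Metric.sphere (0 : E3) 1 in 𝓝 v, ⟪F.n, (w : E3)⟫ ≠ 0 := by
    have : ContinuousAt (fun w : Metric.sphere (0 : E3) 1 => ⟪F.n, (w : E3)⟫) v := by fun_prop
    exact this.eventually_ne hFv
  have hev₅ : ∀ᶠ w in 𝓝 v, w ≠ -v := by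
    refine isOpen_ne.eventually_mem fun h => ?_
    exact ne_neg_of_mem_unit_sphere ℝ v h
  filter_upwards [hev₁, hev₂, hev₃, hev₄, hev₅] with w hw₁ hw₂ hw₃ hw₄ hw₅
  rcases eq_or_ne w v with rfl | hwv
  · exact ⟨h₁, h₂⟩
  have hFt : ⟪F.n, T.δ w + t w • (w : E3)⟫ = F.c := by
    rw [inner_add_right, inner_smul_right]
    simp only [t]
    rw [div_mul_cancel₀ _ hw₄]; ring
  have ht : T.δ w + t w • (w : E3) ∈ interior K := hball (by rwa [mem_ball_iff_norm])
  have hsmall {n : E3} (hn : ‖n‖ = 1) (hnw : ⟪n, (w : E3)⟫ = 0) : |⟪n, (v : E3)⟫| < μ / 4 := by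
    have h3 : ⟪n, (v : E3)⟫ = -⟪n, (w : E3) - v⟫ := by rw [inner_sub_right, hnw]; ring
    have h4 := abs_real_inner_le_norm n ((w : E3) - v)
    rw [hn, one_mul] at h4
    rw [h3, abs_neg]
    exact h4.trans_lt hw₁
  have hbd {n d : E3} (hn : ‖n‖ = 1) (hd : ‖d‖ ≤ R) : |⟪n, d⟫| ≤ R := by
    have h4 := abs_real_inner_le_norm n d
    rw [hn, one_mul] at h4
    exact h4.trans hd
  have htri {P H : EllSection K} (hP : ⟪P.n, T.δ w⟫ = P.c) (hPw : ⟪P.n, (w : E3)⟫ = 0)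
      (hPn : ‖P.n‖ = 1) (hH : ⟪H.n, o⟫ = H.c) (hHR : ‖cross3 H.n F.n‖ ≤ R)
      (hd : ε ≤ |⟪P.n, cross3 H.n F.n⟫|) :
      (∃ x ∈ interior K, ⟪P.n, x⟫ = P.c ∧ ⟪H.n, x⟫ = H.c ∧ ⟪F.n, x⟫ = F.c) ∧
        ⟪P.n, cross3 H.n F.n⟫ ≠ 0 :=
    ⟨exists_mem_three_planes hball hH hFs (inner_add_smul hP hPw (t w)) hPn hε0 hd
      ((mul_le_mul_of_nonneg_left hHR (norm_nonneg _)).trans_lt hw₃),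
      abs_pos.mp (hε0.trans_le hd)⟩
  have hn₁ := T.norm_n₁ w
  have hn₂ := T.norm_n₂ w
  have hm := hmatch _ _ hn₁ hn₂ (T.inner_le w)
  have hs₁ := hsmall hn₁ (T.inner_n₁ w)
  have hs₂ := hsmall hn₂ (T.inner_n₂ w)
  rcases le_or_gt (μ / 4) (|⟪(T.S₁ w).n, d₁⟫| * |⟪(T.S₂ w).n, d₂⟫|) with hp | hp
  · have e₁ := le_of_le_mul (abs_nonneg _) hR (hbd hn₂ hR₂) hp
    have e₂ := le_of_le_mul (abs_nonneg _) hR (hbd hn₁ hR₁) (hp.trans_eq (mul_comm _ _))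
    obtain ⟨t₂, t₂'⟩ := htri (T.inner_n₂_δ w) (T.inner_n₂ w) hn₂ h₂s hR₂ e₂
    obtain ⟨t₁, t₁'⟩ := htri (T.inner_n₁_δ w) (T.inner_n₁ w) hn₁ h₁s hR₁ e₁
    exact (T.goodFor_of_ne hK hconv hq hwv hw₅ h₁ h₂ hF hFv hFs hs hw₄ hFt ht
      (T.inner_n₂_δ w) (T.inner_n₂ w) (T.inner_n₁_δ w) (T.inner_n₁ w) t₂ t₂' t₁ t₁').symm
  · have hp' : μ / 4 ≤ |⟪(T.S₁ w).n, d₂⟫| * |⟪(T.S₂ w).n, d₁⟫| := by linarith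
    have e₁ := le_of_le_mul (abs_nonneg _) hR (hbd hn₂ hR₁) hp'
    have e₂ := le_of_le_mul (abs_nonneg _) hR (hbd hn₁ hR₂) (hp'.trans_eq (mul_comm _ _))
    obtain ⟨t₂, t₂'⟩ := htri (T.inner_n₂_δ w) (T.inner_n₂ w) hn₂ h₁s hR₁ e₂
    obtain ⟨t₁, t₁'⟩ := htri (T.inner_n₁_δ w) (T.inner_n₁ w) hn₁ h₂s hR₂ e₁
    exact T.goodFor_of_ne hK hconv hq hwv hw₅ h₁ h₂ hF hFv hFs hs hw₄ hFt ht
      (T.inner_n₁_δ w) (T.inner_n₁ w) (T.inner_n₂_δ w) (T.inner_n₂ w) t₁ t₁' t₂ t₂'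

end SectionSystem

instance connectedSpace_sphere : ConnectedSpace (Metric.sphere (0 : E3) 1) :=
  Subtype.connectedSpace (isConnected_sphere (Module.lt_rank_of_lt_finrank (by simp)) 0 zero_le_one)

namespace SectionSystem

open Filter Topology

theorem eq_const_mul_of_goodFor (T : SectionSystem K) {q q' : E3 → ℝ} (hq : IsQuad q)
    (hq' : IsQuad q') {u v : Metric.sphere (0 : E3) 1} (huv : v ≠ u) (huv' : v ≠ -u)
    (hu : GoodFor q (T.S₁ u) ∧ GoodFor q (T.S₂ u))
    (hu' : GoodFor q' (T.S₁ u) ∧ GoodFor q' (T.S₂ u))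
    (hv : GoodFor q (T.S₁ v) ∧ GoodFor q (T.S₂ v))
    (hv' : GoodFor q' (T.S₁ v) ∧ GoodFor q' (T.S₂ v)) :
    ∃ κ : ℝ, 0 < κ ∧ ∀ x, q x = κ * q' x := by
  obtain ⟨-, s, -, -, hs⟩ := T.exists_transversal u
  exact GoodFor.eq_const_mul hq hq' hu.1 hu.2 hu'.1 hu'.2
    (inner_add_smul (T.inner_n₁_δ u) (T.inner_n₁ u) s)
    (inner_add_smul (T.inner_n₂_δ u) (T.inner_n₂ u) s) hs (T.cross3_ne_zero u)
    hv.1 hv.2 hv'.1 hv'.2 (T.cross3_ne_zero v) (T.inner_n₁_δ v) (T.inner_n₂_δ v)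
    (T.inner_n₁ v) (T.inner_n₂ v) (T.inner_ne_zero_or huv huv')

/-- All sections of the system fit one quadratic function. -/
theorem exists_forall_goodFor (T : SectionSystem K) (hK : IsCompact K) (hconv : Convex ℝ K) :
    ∃ q, IsQuad q ∧ ∀ w, GoodFor q (T.S₁ w) ∧ GoodFor q (T.S₂ w) := by
  obtain ⟨w₀⟩ : Nonempty (Metric.sphere (0 : E3) 1) := inferInstance
  obtain ⟨q, hq, h₀⟩ := T.exists_eventually_goodFor hK hconv w₀
  refine ⟨q, hq, ?_⟩
  have : Nontrivial (Metric.sphere (0 : E3) 1) := ⟨w₀, -w₀, ne_neg_of_mem_unit_sphere ℝ w₀⟩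
  set G := {w | ∀ᶠ w' in 𝓝 w, GoodFor q (T.S₁ w') ∧ GoodFor q (T.S₂ w')} with hG
  have hopen : IsOpen G := isOpen_setOfPred_eventually_nhds
  have hclosed : IsClosed G := by
    refine isClosed_of_closure_subset fun v hv => ?_
    obtain ⟨q', hq', h'⟩ := T.exists_eventually_goodFor hK hconv v
    obtain ⟨u, hu, hu'⟩ := ((mem_closure_iff_frequently.mp hv).and_eventually
      (eventually_eventually_nhds.mpr h')).exists
    have hev : ∀ᶠ w in 𝓝 u, w ≠ -u :=
      isOpen_ne.eventually_mem (ne_neg_of_mem_unit_sphere ℝ u)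
    obtain ⟨w, hwu, hw, hw', hwn⟩ := (eventually_mem_nhdsWithin.and
      (nhdsWithin_le_nhds (s := {u}ᶜ) (hu.and (hu'.and hev)))).exists
    obtain ⟨κ, hκ, h⟩ := T.eq_const_mul_of_goodFor hq hq' hwu hwn hu.self_of_nhds
      hu'.self_of_nhds hw hw'
    have hmul {S : EllSection K} : GoodFor q' S → GoodFor q S := by
      rintro ⟨k, hk, hS⟩
      exact ⟨κ * k, mul_pos hκ hk, fun x hx => by rw [h, hS x hx, mul_assoc]⟩
    exact h'.mono fun w hw => ⟨hmul hw.1, hmul hw.2⟩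
  have huniv : G = Set.univ := IsClopen.eq_univ ⟨hclosed, hopen⟩ ⟨w₀, h₀⟩
  intro w
  have hw : ∀ᶠ w' in 𝓝 w, GoodFor q (T.S₁ w') ∧ GoodFor q (T.S₂ w') := by
    have : w ∈ G := huniv ▸ Set.mem_univ w
    exact this
  exact hw.self_of_nhds

end SectionSystem

theorem eq_of_exp_eq {A : Type*} [TopologicalSpace A] [PreconnectedSpace A] {f : A → ℂ}
    (hf : Continuous f) (h : ∀ a a', Complex.exp (f a) = Complex.exp (f a')) (a a' : A) :
    f a = f a' :=
  Complex.isCoveringMap_exp.const_of_comp hf (fun a a' => Subtype.ext (h a a')) a a'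

/-- The point of the unit sphere with given polar angle and azimuth. -/
noncomputable def spherePoint (φ θ : ℝ) : E3 :=
  !₂[Real.sin φ * Real.cos θ, Real.sin φ * Real.sin θ, Real.cos φ]

theorem spherePoint_mem (φ θ : ℝ) : spherePoint φ θ ∈ Metric.sphere (0 : E3) 1 := by
  rw [mem_sphere_zero_iff_norm, ← sq_eq_sq₀ (norm_nonneg _) zero_le_one,
    ← real_inner_self_eq_norm_sq, inner_E3]
  simp only [spherePoint, PiLp.toLp_apply, Matrix.cons_val]
  linear_combination Real.sin φ ^ 2 * Real.sin_sq_add_cos_sq θ + Real.sin_sq_add_cos_sq φ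

/-- The derivative of `spherePoint` in the polar angle. -/
noncomputable def polarVector (φ θ : ℝ) : E3 :=
  !₂[Real.cos φ * Real.cos θ, Real.cos φ * Real.sin θ, -Real.sin φ]

/-- The unit tangent vector in the direction of increasing azimuth. -/
noncomputable def azimuthVector (θ : ℝ) : E3 := !₂[-Real.sin θ, Real.cos θ, 0]

/-- Pointwise tangent even vector fields on the sphere vanish somewhere. -/
theorem exists_eq_zero_of_even {X : Metric.sphere (0 : E3) 1 → E3} (hX : Continuous X)
    (htan : ∀ w, ⟪X w, (w : E3)⟫ = 0) (heven : ∀ w, X (-w) = X w) : ∃ w, X w = 0 := by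
  by_contra! hne
  let N (φ θ : ℝ) : Metric.sphere (0 : E3) 1 := ⟨spherePoint φ θ, spherePoint_mem φ θ⟩
  let y (φ θ : ℝ) : ℂ := ⟨⟪X (N φ θ), polarVector φ θ⟫, ⟪X (N φ θ), azimuthVector θ⟫⟩
  have hy (φ θ : ℝ) : y φ θ ≠ 0 := by
    intro h0
    have h1 : ⟪X (N φ θ), polarVector φ θ⟫ = 0 := congrArg Complex.re h0
    have h2 : ⟪X (N φ θ), azimuthVector θ⟫ = 0 := congrArg Complex.im h0
    have h3 : ⟪X (N φ θ), spherePoint φ θ⟫ = 0 := htan (N φ θ)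
    simp only [inner_E3, spherePoint, polarVector, azimuthVector,
      Matrix.cons_val] at h1 h2 h3
    have hθ := Real.sin_sq_add_cos_sq θ
    have hφ := Real.sin_sq_add_cos_sq φ
    set x := X (N φ θ)
    have h4 : x 0 * Real.cos θ + x 1 * Real.sin θ = 0 := by
      linear_combination Real.cos φ * h1 + Real.sin φ * h3
        - (x 0 * Real.cos θ + x 1 * Real.sin θ) * hφ
    apply hne (N φ θ)
    apply ext_E3
    · change x 0 = 0
      linear_combination Real.cos θ * h4 - Real.sin θ * h2 - x 0 * hθ
    · change x 1 = 0
      linear_combination Real.sin θ * h4 + Real.cos θ * h2 - x 1 * hθ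
    · change x 2 = 0
      linear_combination Real.cos φ * h3 - Real.sin φ * h1 - x 2 * hφ
  let z : C(ℝ × ℝ, ℂ) := ⟨fun p => y p.1 p.2 * Complex.exp (p.2 * Complex.I), by
    have hN : Continuous fun p : ℝ × ℝ => N p.1 p.2 := by
      refine Continuous.subtype_mk ?_ _
      simp only [spherePoint]
      fun_prop
    have : Continuous fun p : ℝ × ℝ => y p.1 p.2 := by
      rw [← Complex.equivRealProdCLM.comp_continuous_iff]
      simp only [y, polarVector, azimuthVector]
      refine Continuous.prodMk ?_ ?_
      · exact (hX.comp hN).inner (by fun_prop)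
      · exact (hX.comp hN).inner (by fun_prop)
    fun_prop⟩
  have hz (p : ℝ × ℝ) : z p ≠ 0 := mul_ne_zero (hy _ _) (Complex.exp_ne_zero _)
  obtain ⟨ζ, ⟨-, hζ⟩, -⟩ := Complex.isCoveringMapOn_exp.existsUnique_continuousMap_lifts z
    (a₀ := 0) (Complex.exp_log (hz 0)) hz
  have hexp (φ θ : ℝ) : Complex.exp (ζ (φ, θ)) = y φ θ * Complex.exp (θ * Complex.I) :=
    congrFun hζ (φ, θ)
  have hc := ζ.continuous
  have hper (φ θ : ℝ) : y φ (θ + 2 * Real.pi) = y φ θ := by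
    simp only [y, N, spherePoint, polarVector, azimuthVector, Real.sin_add_two_pi,
      Real.cos_add_two_pi]
  have hD : ζ (Real.pi / 2, 2 * Real.pi) = ζ (Real.pi / 2, 0) := by
    have h1 : ζ (0, 2 * Real.pi) = ζ (0, 0) := by
      refine eq_of_exp_eq (f := fun θ : ℝ => ζ (0, θ)) (by fun_prop) (fun θ θ' => ?_) _ _
      have h0 (θ : ℝ) : y 0 θ * Complex.exp (θ * Complex.I) = y 0 0 := by
        have hN : N 0 θ = N 0 0 := Subtype.ext (by simp [N, spherePoint])
        simp only [y, hN]
        apply Complex.ext <;> simp [inner_E3, polarVector, azimuthVector,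
          Complex.exp_ofReal_mul_I_re, Complex.exp_ofReal_mul_I_im]
        · linear_combination (X (N 0 0) 0) * Real.sin_sq_add_cos_sq θ
        · linear_combination (X (N 0 0) 1) * Real.sin_sq_add_cos_sq θ
      rw [hexp, hexp, h0, h0]
    have h2 := eq_of_exp_eq (f := fun φ : ℝ => ζ (φ, 2 * Real.pi) - ζ (φ, 0)) (by fun_prop)
      (fun φ φ' => ?_) (Real.pi / 2) 0
    · simpa [h1, sub_eq_zero] using h2
    · have h3 (φ : ℝ) : Complex.exp (ζ (φ, 2 * Real.pi) - ζ (φ, 0)) = 1 := by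
        rw [Complex.exp_sub, hexp, hexp, ← zero_add (2 * Real.pi), hper, div_eq_one_iff_eq]
        · simp
        · simpa using hy φ 0
      rw [h3, h3]
  let η (θ : ℝ) : ℂ := ζ (Real.pi / 2, θ) - θ * Complex.I
  have hη (θ : ℝ) : Complex.exp (η θ) = y (Real.pi / 2) θ := by
    rw [Complex.exp_sub, hexp, mul_div_cancel_right₀ _ (Complex.exp_ne_zero _)]
  have hconj (θ : ℝ) : y (Real.pi / 2) (θ + Real.pi) = (starRingEnd ℂ) (y (Real.pi / 2) θ) := by
    have hN : N (Real.pi / 2) (θ + Real.pi) = -N (Real.pi / 2) θ := by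
      apply Subtype.ext
      apply ext_E3 <;> simp [N, spherePoint]
    simp only [y, hN, heven]
    apply Complex.ext <;> simp [inner_E3, polarVector, azimuthVector]
    ring
  have hconst := eq_of_exp_eq (f := fun θ : ℝ => η (θ + Real.pi) - (starRingEnd ℂ) (η θ))
    (by simp only [η]; fun_prop) (fun θ θ' => by
      have h3 (θ : ℝ) : Complex.exp (η (θ + Real.pi) - (starRingEnd ℂ) (η θ)) = 1 := by
        rw [Complex.exp_sub, Complex.exp_conj, hη, hη, hconj, div_self]
        exact (map_ne_zero _).mpr (hy _ _)
      rw [h3, h3]) Real.pi 0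
  have him := congrArg Complex.im hconst
  simp [η, ← two_mul, hD] at him
  linarith [Real.pi_pos]

theorem exists_linearEquiv_of_posDef {M : E3 →ₗ[ℝ] E3 →ₗ[ℝ] ℝ} (hM : ∀ u, u ≠ 0 → 0 < M u u) :
    ∃ f : E3 ≃ₗ[ℝ] E3, ∀ x, M x x = ⟪f x, f x⟫ := by
  let Q : QuadraticForm ℝ E3 := LinearMap.BilinMap.toQuadraticMap M
  have hQ := QuadraticForm.equivalent_signType_weighted_sum_squared Q
  rw [finrank_euclideanSpace_fin] at hQ
  obtain ⟨s, ⟨e⟩⟩ := hQ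
  have he (y : Fin 3 → ℝ) : M (e.symm y) (e.symm y) = ∑ i, (s i : ℝ) * (y i * y i) :=
    (e.symm.map_app y).trans (QuadraticMap.weightedSumSquares_apply _ _)
  have hs (i : Fin 3) : (s i : ℝ) = 1 := by
    have h1 := hM (e.symm (Pi.single i 1)) (by
      rw [Ne, EmbeddingLike.map_eq_zero_iff]; simp)
    rw [he] at h1
    simp [Pi.single_apply] at h1
    cases hsi : s i
    · simp [hsi] at h1
    · rw [hsi] at h1; norm_num at h1
    · simp
  refine ⟨e.toLinearEquiv.trans (WithLp.linearEquiv 2 ℝ (Fin 3 → ℝ)).symm, fun x => ?_⟩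
  have h2 := he (e x)
  simp only [hs, one_mul] at h2
  rw [QuadraticMap.IsometryEquiv.symm_apply_apply] at h2
  rw [h2, inner_E3, Fin.sum_univ_three]
  rfl

theorem IsQuad.isEllipsoid {q : E3 → ℝ} (hq : IsQuad q)
    (hconv : ∀ u, u ≠ 0 → ∃ x, 2 * q x < q (x + u) + q (x - u)) {o : E3} (ho : q o < 0) :
    IsEllipsoid {x | q x = 0} := by
  obtain ⟨M, l, c, h⟩ := hq
  have hM (u : E3) (hu : u ≠ 0) : 0 < M u u := by
    obtain ⟨x, hx⟩ := hconv u hu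
    simp [h] at hx
    linarith
  obtain ⟨f, hf⟩ := exists_linearEquiv_of_posDef hM
  set g := (InnerProductSpace.toDual ℝ E3).symm (l ∘ₗ f.symm.toLinearMap).toContinuousLinearMap
    with hg
  have hl (x : E3) : l x = ⟪g, f x⟫ := by
    rw [hg, InnerProductSpace.toDual_symm_apply]; simp
  set m := (2⁻¹ : ℝ) • g with hm
  have hq' (x : E3) : q x = ‖f x + m‖ ^ 2 - (‖m‖ ^ 2 - c) := by
    rw [h, hf, hl, norm_add_sq_real, real_inner_self_eq_norm_sq, hm, inner_smul_right,
      real_inner_comm (f x) g]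
    ring
  have hR : 0 < ‖m‖ ^ 2 - c := by
    rw [hq'] at ho
    linarith [sq_nonneg ‖f o + m‖]
  set R := √(‖m‖ ^ 2 - c)
  have hR0 : 0 < R := Real.sqrt_pos.mpr hR
  have hR2 : R ^ 2 = ‖m‖ ^ 2 - c := Real.sq_sqrt hR.le
  let F : E3 ≃ᵃ[ℝ] E3 := (f.toAffineEquiv.trans (AffineEquiv.constVAdd ℝ E3 m)).trans
    (LinearEquiv.smulOfNeZero ℝ E3 R⁻¹ (inv_ne_zero hR0.ne')).toAffineEquiv
  refine ⟨F.symm, ?_⟩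
  ext x
  change _ ↔ x ∈ F.toEquiv.symm '' _
  rw [Equiv.image_symm_eq_preimage, Set.mem_preimage, mem_sphere_zero_iff_norm, Set.mem_ofPred_eq,
    hq', ← hR2, sub_eq_zero, sq_eq_sq₀ (norm_nonneg _) hR0.le]
  have hF : F.toEquiv x = R⁻¹ • (m + f x) := rfl
  rw [hF, norm_smul, norm_inv, Real.norm_of_nonneg hR0.le, inv_mul_eq_one₀ hR0.ne', add_comm m,
    eq_comm]

namespace SectionSystem

/-- The lines of the system cover the space. -/
theorem exists_eq_add_smul (T : SectionSystem K) (p : E3) :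
    ∃ (w : Metric.sphere (0 : E3) 1) (t : ℝ), p = T.δ w + t • (w : E3) := by
  have hδ := T.continuous_δ
  have hw (w : Metric.sphere (0 : E3) 1) : ⟪(w : E3), (w : E3)⟫ = 1 := by
    rw [real_inner_self_eq_norm_sq]; simp
  obtain ⟨w, h⟩ := exists_eq_zero_of_even
    (X := fun w : Metric.sphere (0 : E3) 1 => p - ⟪p, (w : E3)⟫ • (w : E3) - T.δ w) (by fun_prop)
    (fun w => by
      rw [inner_sub_left, inner_sub_left, inner_smul_left, hw,
        real_inner_comm (w : E3) (T.δ w), T.inner_δ]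
      simp)
    (fun w => by simp [T.δ_neg])
  exact ⟨w, ⟪p, (w : E3)⟫, by
    rw [sub_sub, sub_eq_zero] at h
    rw [add_comm]
    exact h⟩

theorem isEllipsoid_frontier (T : SectionSystem K) (hK : IsCompact K) (hconv : Convex ℝ K)
    (hint : (interior K).Nonempty) : IsEllipsoid (frontier K) := by
  obtain ⟨q, hq, hgood⟩ := T.exists_forall_goodFor hK hconv
  have hmem (x : E3) : ∃ S : EllSection K, GoodFor q S ∧ ⟪S.n, x⟫ = S.c := by
    obtain ⟨w, t, rfl⟩ := T.exists_eq_add_smul x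
    exact ⟨T.S₁ w, (hgood w).1, inner_add_smul (T.inner_n₁_δ w) (T.inner_n₁ w) t⟩
  have hfr : frontier K = {x | q x = 0} := by
    ext x
    obtain ⟨S, ⟨k, hk, hS⟩, hx⟩ := hmem x
    rw [S.mem_frontier x hx, Set.mem_ofPred_eq, hS x hx, mul_eq_zero_iff_left hk.ne']
  obtain ⟨o, ho⟩ := hint
  obtain ⟨S, hS, hoS⟩ := hmem o
  rw [hfr]
  refine hq.isEllipsoid (fun u hu => ?_) (hS.neg hoS ho)
  let w : Metric.sphere (0 : E3) 1 := ⟨‖u‖⁻¹ • u, by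
    rw [mem_sphere_zero_iff_norm]; exact norm_smul_inv_norm (𝕜 := ℝ) hu⟩
  obtain ⟨k, hk, hw⟩ := (hgood w).1
  have hn : ⟪(T.S₁ w).n, u⟫ = 0 := by
    have := T.inner_n₁ w
    simpa [w, inner_smul_right, hu] using this
  have h0 := T.inner_n₁_δ w
  refine ⟨T.δ w, ?_⟩
  rw [hw _ h0, hw _ (by rw [inner_add_right, hn, h0, add_zero]),
    hw _ (by rw [inner_sub_right, hn, h0, sub_zero])]
  nlinarith [(T.S₁ w).convex u hu hn (T.δ w)]

end SectionSystem

end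

/-- If there is a continuous system of lines whose center lies in the
interior of the convex body `K` and through every line of the system there are two
elliptic sections making an angle at least `α`, then the boundary is an ellipsoid. -/
theorem line_system_elliptic_sections_ellipsoid (K : Set E3) (hK : IsConvexBody K)
    (α : ℝ) (hα : 0 < α) (𝓛 : Set (Set E3)) (h𝓛 : IsContinuousLineSystem 𝓛)
    (hcenter : lineSystemCenter 𝓛 ⊆ interior K)
    (h : ∀ L ∈ 𝓛, ∃ (H₁ H₂ : Set E3) (n₁ n₂ : E3),
      IsPlaneWithNormal H₁ n₁ ∧ IsPlaneWithNormal H₂ n₂ ∧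
      H₁ ∩ H₂ = L ∧
      α ≤ Real.arccos |⟪n₁, n₂⟫| ∧
      IsEllipse (frontier K ∩ H₁) ∧ IsEllipse (frontier K ∩ H₂)) :
    IsEllipsoid (frontier K) := by
  obtain ⟨T⟩ := nonempty_sectionSystem hK.1 hK.2.1 hα h𝓛 hcenter h
  exact T.isEllipsoid_frontier hK.1 hK.2.1 hK.2.2
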